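/- arXiv:2003.14232 — 3 statements merged into one kernel-verified Lean document; each statement's English description precedes it below -/
import Mathlib

section
/- Let K be a field of positive characteristic p and let H be the generic r×s Hankel matrix in S = K[x₁,…,xₙ] with n = r+s−1. Then for every t ≤ min(r,s), the determinantal ring S/I_t(H) is F-pure. -/
/-- `I_t(M)` : the ideal generated by the `t × t` minors of a matrix `M`. -/
noncomputable def minorsIdeal {R : Type*} [CommRing R] {r s : ℕ} (t : ℕ)
    (M : Matrix (Fin r) (Fin s) R) : Ideal R :=
  Ideal.span {d | ∃ (ρ : Fin t → Fin r) (γ : Fin t → Fin s),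
    StrictMono ρ ∧ StrictMono γ ∧ d = (M.submatrix ρ γ).det}

/-- The generic `r × s` Hankel matrix with entries `x₁, …, x_{r+s-1}`
(zero-indexed: entry `(i,j)` is `X (i+j)`). -/
noncomputable def hankelGen (K : Type*) [Field K] (r s : ℕ) :
    Matrix (Fin r) (Fin s) (MvPolynomial (Fin (r + s - 1)) K) :=
  fun i j => MvPolynomial.X ⟨i.1 + j.1, by have := i.isLt; have := j.isLt; omega⟩

/-- A ring homomorphism `f : R →+* S` is *pure* if for every `R`-module `M` the induced map
`M → S ⊗[R] M`, `x ↦ 1 ⊗ x`, is injective (equivalently, `f ⊗ id_M` is injective for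
every `M`). -/
def IsPureRingHom {R S : Type*} [CommRing R] [CommRing S] (f : R →+* S) : Prop :=
  letI : Algebra R S := f.toAlgebra
  ∀ (M : Type*) [AddCommGroup M] [Module R M],
    Function.Injective (fun x : M => ((1 : S) ⊗ₜ[R] x : TensorProduct R S M))

namespace HankelFP

open MvPolynomial

/-- A ring homomorphism with an additive left inverse that is linear over the source is pure. -/
theorem isPure_of_split {R S : Type*} [CommRing R] [CommRing S] (f : R →+* S)
    (τ : S →+ R) (hτ : ∀ r s, τ (f r * s) = r * τ s) (h1 : τ 1 = 1) : IsPureRingHom f := by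
  let _ : Algebra R S := f.toAlgebra
  intro M _ _ x y hxy
  let T : S →ₗ[R] R :=
    { toFun := τ
      map_add' := τ.map_add
      map_smul' := fun r s => by
        simp only [Algebra.smul_def, RingHom.id_apply]
        exact hτ r s }
  have h := congrArg (fun z => TensorProduct.lid R M (LinearMap.rTensor M T z)) hxy
  have hT : T 1 = 1 := h1
  simpa [hT] using h

theorem exists_field_split_aux {K E : Type*} [Field K] [Field E] (f : K →+* E) :
    ∃ σ : E →+ K, (∀ a b, σ (f a * b) = a * σ b) ∧ σ 1 = 1 := by
  let _ : Algebra K E := f.toAlgebra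
  obtain ⟨g, hg⟩ := LinearMap.exists_leftInverse_of_injective (Algebra.linearMap K E)
    (LinearMap.ker_eq_bot.2 (algebraMap K E).injective)
  refine ⟨g.toAddMonoidHom, fun a b => ?_, ?_⟩
  · have := g.map_smul a b
    rw [Algebra.smul_def] at this
    exact this
  · have := LinearMap.congr_fun hg 1
    simpa using this

/-- Any field of characteristic `p` is Frobenius split. -/
theorem exists_field_split (K : Type*) [Field K] (p : ℕ) [Fact p.Prime] [CharP K p] :
    ∃ σ : K →+ K, (∀ a b, σ (a ^ p * b) = a * σ b) ∧ σ 1 = 1 :=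
  exists_field_split_aux (frobenius K p)

/-- The exponent `p b + (p-1)`. -/
noncomputable def shiftExp {ι : Type*} [Fintype ι] (p : ℕ) (b : ι →₀ ℕ) : ι →₀ ℕ :=
  p • b + Finsupp.equivFunOnFinite.symm (fun _ => p - 1)

theorem shiftExp_apply {ι : Type*} [Fintype ι] (p : ℕ) (b : ι →₀ ℕ) (i : ι) :
    shiftExp p b i = p * b i + (p - 1) := by
  simp [shiftExp]

theorem shiftExp_injective {ι : Type*} [Fintype ι] {p : ℕ} (hp : 0 < p) :
    Function.Injective (shiftExp (ι := ι) p) := by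
  intro a b h
  ext i
  have := DFunLike.congr_fun h i
  rw [shiftExp_apply, shiftExp_apply] at this
  exact Nat.eq_of_mul_eq_mul_left hp (by omega)

theorem exists_trace {K ι : Type*} [Field K] [Fintype ι] (p : ℕ) [Fact p.Prime] [CharP K p]
    (σ : K →+ K) (hσ : ∀ a b, σ (a ^ p * b) = a * σ b) :
    ∃ Φ : MvPolynomial ι K →+ MvPolynomial ι K,
      (∀ g b, coeff b (Φ g) = σ (coeff (shiftExp p b) g)) ∧
      ∀ h g, Φ (h ^ p * g) = h * Φ g := by
  classical
  have hp : 0 < p := (Fact.out : p.Prime).pos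
  let Φ0 : MvPolynomial ι K → MvPolynomial ι K := fun g =>
    AddMonoidAlgebra.ofCoeff ((Finsupp.comapDomain (shiftExp p) (AddMonoidAlgebra.coeff g)
      (shiftExp_injective hp).injOn).mapRange σ (map_zero σ))
  have h0 : ∀ g b, coeff b (Φ0 g) = σ (coeff (shiftExp p b) g) := fun g b => rfl
  let Φ : MvPolynomial ι K →+ MvPolynomial ι K :=
    { toFun := Φ0
      map_zero' := by ext b; simp [h0]
      map_add' := fun x y => by ext b; simp [h0] }
  have h0 : ∀ g b, coeff b (Φ g) = σ (coeff (shiftExp p b) g) := fun g b => rfl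
  refine ⟨Φ, h0, fun h g => ?_⟩
  induction h using MvPolynomial.induction_on' with
  | monomial c k =>
    ext b
    rw [monomial_pow, h0, coeff_monomial_mul', coeff_monomial_mul']
    have hiff : p • c ≤ shiftExp p b ↔ c ≤ b := by
      simp only [Finsupp.le_def, shiftExp_apply, Finsupp.smul_apply, smul_eq_mul]
      refine forall_congr' fun i => ⟨fun h => ?_, fun h => ?_⟩
      · have : p * c i < p * (b i + 1) := by rw [Nat.mul_add]; omega
        have := Nat.lt_of_mul_lt_mul_left this
        omega
      · exact (Nat.mul_le_mul_left p h).trans (Nat.le_add_right _ _)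
    simp only [hiff]
    split_ifs with hc
    · rw [hσ, h0]
      congr 3
      ext i
      have := Nat.mul_le_mul_left p (hc i)
      simp only [shiftExp_apply, Finsupp.tsub_apply, Finsupp.smul_apply, smul_eq_mul, Nat.mul_sub]
      omega
    · simp
  | add a b ha hb =>
    rw [add_pow_char, add_mul, map_add, ha, hb, add_mul]

/-- quadratic weight of an exponent vector -/
def qw {n : ℕ} (a : Fin n →₀ ℕ) : ℕ := ∑ k, a k * (k : ℕ) ^ 2

theorem qw_add {n : ℕ} (a b : Fin n →₀ ℕ) : qw (a + b) = qw a + qw b := by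
  simp [qw, add_mul, Finset.sum_add_distrib]

theorem qw_zero {n : ℕ} : qw (0 : Fin n →₀ ℕ) = 0 := by simp [qw]

theorem qw_single {n : ℕ} (k : Fin n) : qw (Finsupp.single k 1) = (k : ℕ) ^ 2 := by
  simp [qw, Finsupp.single_apply]

theorem qw_sum {n : ℕ} {ι : Type*} (s : Finset ι) (f : ι → Fin n →₀ ℕ) :
    qw (∑ i ∈ s, f i) = ∑ i ∈ s, qw (f i) := by
  classical
  induction s using Finset.induction_on with
  | empty => simp [qw_zero]
  | insert a s ha ih => rw [Finset.sum_insert ha, Finset.sum_insert ha, qw_add, ih]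

/-- `a` is the leading exponent of `g` for the weight `qw`, with coefficient one. -/
def HasLead {n : ℕ} {K : Type*} [Field K] (g : MvPolynomial (Fin n) K) (a : Fin n →₀ ℕ) : Prop :=
  coeff a g = 1 ∧ ∀ b, coeff b g ≠ 0 → b ≠ a → qw b < qw a

variable {n : ℕ} {K : Type*} [Field K]

theorem HasLead.le {g : MvPolynomial (Fin n) K} {a b} (h : HasLead g a) (hb : coeff b g ≠ 0) :
    qw b ≤ qw a := by
  by_cases hab : b = a
  · rw [hab]
  · exact (h.2 b hb hab).le

theorem HasLead.mul {g h : MvPolynomial (Fin n) K} {a b} (hg : HasLead g a) (hh : HasLead h b) :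
    HasLead (g * h) (a + b) := by
  classical
  have key : ∀ x y, coeff x g * coeff y h ≠ 0 → (x, y) ≠ (a, b) → qw (x + y) < qw (a + b) := by
    intro x y hxy hne
    have hx := left_ne_zero_of_mul hxy
    have hy := right_ne_zero_of_mul hxy
    rw [qw_add, qw_add]
    by_cases hxa : x = a
    · have hyb : y ≠ b := fun hyb => hne (by rw [hxa, hyb])
      exact add_lt_add_of_le_of_lt (hg.le hx) (hh.2 y hy hyb)
    · exact add_lt_add_of_lt_of_le (hg.2 x hx hxa) (hh.le hy)
  constructor
  · rw [coeff_mul, Finset.sum_eq_single (a, b)]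
    · rw [hg.1, hh.1, one_mul]
    · intro z hz hne
      by_contra h0
      have := key z.1 z.2 h0 hne
      rw [Finset.HasAntidiagonal.mem_antidiagonal.1 hz] at this
      exact lt_irrefl _ this
    · intro h0
      exact absurd (Finset.HasAntidiagonal.mem_antidiagonal (n := a + b) (a := (a, b)) |>.2 rfl) h0
  · intro c hc hne
    rw [coeff_mul] at hc
    obtain ⟨z, hz, hz0⟩ := Finset.exists_ne_zero_of_sum_ne_zero hc
    have hz' := Finset.HasAntidiagonal.mem_antidiagonal.1 hz
    rw [← hz']
    refine key z.1 z.2 hz0 fun h => hne ?_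
    rw [← hz', ← (Prod.mk.inj h).1, ← (Prod.mk.inj h).2]

theorem HasLead.one : HasLead (1 : MvPolynomial (Fin n) K) 0 := by
  classical
  constructor
  · simp
  · intro b hb hne
    rw [coeff_one] at hb
    exact absurd (by simpa using hb) (Ne.symm hne)

theorem HasLead.pow {g : MvPolynomial (Fin n) K} {a} (hg : HasLead g a) (N : ℕ) :
    HasLead (g ^ N) (N • a) := by
  induction N with
  | zero => simpa using HasLead.one
  | succ N ih => rw [pow_succ, succ_nsmul]; exact ih.mul hg

/-- Variables indexed by natural numbers, zero out of range. -/
noncomputable def xv (n : ℕ) (K : Type*) [Field K] (k : ℕ) : MvPolynomial (Fin n) K :=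
  if h : k < n then X ⟨k, h⟩ else 0

theorem xv_of_lt {k : ℕ} (h : k < n) : xv n K k = X ⟨k, h⟩ := dif_pos h

theorem perm_sum_sq_lt {d : ℕ} (i j : Fin d → ℕ) (hi : StrictMono i) (hj : StrictMono j)
    (σ : Equiv.Perm (Fin d)) (hσ : σ ≠ 1) :
    ∑ k, (i (σ k) + j k) ^ 2 < ∑ k, (i k + j k) ^ 2 := by
  have hm : Monovary j i := fun a b h => hj.monotone (hi.lt_iff_lt.1 h).le
  have h := (hm.sum_mul_comp_perm_lt_sum_mul_iff (σ := σ)).2 (by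
    intro hmv
    apply hσ
    have h1 : Monotone (σ.symm : Fin d → Fin d) := by
      intro a b hab
      rcases hab.eq_or_lt with rfl | hlt
      · exact le_rfl
      · have := @hmv (σ.symm a) (σ.symm b) (by simpa using hi hlt)
        exact hj.le_iff_le.1 this
    have h2 : StrictMono (σ.symm : Fin d → Fin d) := h1.strictMono_of_injective σ.symm.injective
    have h3 : ∀ a, σ.symm a = a := by
      intro a
      have := Subsingleton.elim (α := Fin d ≃o Fin d) (h2.orderIsoOfSurjective _ σ.symm.surjective)
        (OrderIso.refl _)
      exact DFunLike.congr_fun this a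
    ext a
    have := h3 (σ a)
    simp at this
    simp [← this])
  have e : ∑ k, i (σ k) ^ 2 = ∑ k, i k ^ 2 := Equiv.sum_comp σ (fun k => i k ^ 2)
  have e1 : ∀ τ : Equiv.Perm (Fin d), ∑ k, (i (τ k) + j k) ^ 2
      = ∑ k, i (τ k) ^ 2 + 2 * ∑ k, j k * i (τ k) + ∑ k, j k ^ 2 := by
    intro τ
    rw [Finset.mul_sum, ← Finset.sum_add_distrib, ← Finset.sum_add_distrib]
    exact Finset.sum_congr rfl fun k _ => by ring
  have e2 := e1 1
  simp only [Equiv.Perm.one_apply] at e2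
  rw [e1 σ, e2, e]
  omega

theorem hasLead_det {d : ℕ} (i j : Fin d → ℕ) (hi : StrictMono i) (hj : StrictMono j)
    (hn : ∀ k l, i k + j l < n) :
    HasLead (Matrix.det (Matrix.of fun k l => xv n K (i k + j l)))
      (∑ k, Finsupp.single ⟨i k + j k, hn k k⟩ 1) := by
  classical
  have hterm : ∀ σ : Equiv.Perm (Fin d), ∏ k, (Matrix.of fun k l => xv n K (i k + j l)) (σ k) k
      = monomial (∑ k, Finsupp.single (⟨i (σ k) + j k, hn _ _⟩ : Fin n) 1) (1 : K) := by
    intro σ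
    rw [monomial_sum_one]
    refine Finset.prod_congr rfl fun k _ => ?_
    rw [Matrix.of_apply, xv_of_lt (hn _ _)]
    rfl
  have hq : ∀ σ : Equiv.Perm (Fin d), qw (∑ k, Finsupp.single (⟨i (σ k) + j k, hn _ _⟩ : Fin n) 1)
      = ∑ k, (i (σ k) + j k) ^ 2 := by
    intro σ
    rw [qw_sum]
    exact Finset.sum_congr rfl fun k _ => by rw [qw_single]
  have hq1 := hq 1
  simp only [Equiv.Perm.one_apply] at hq1
  have hcoeff : ∀ b, coeff b (Matrix.det (Matrix.of fun k l => xv n K (i k + j l)))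
      = ∑ σ : Equiv.Perm (Fin d), ((Equiv.Perm.sign σ : ℤ) : K) *
        (if (∑ k, Finsupp.single (⟨i (σ k) + j k, hn _ _⟩ : Fin n) 1) = b then 1 else 0) := by
    intro b
    rw [Matrix.det_apply', coeff_sum]
    refine Finset.sum_congr rfl fun σ _ => ?_
    rw [hterm σ, ← coeff_monomial, ← coeff_C_mul]
    simp
  constructor
  · rw [hcoeff, Finset.sum_eq_single 1]
    · simp
    · intro σ _ hσ
      rw [if_neg, mul_zero]
      intro h
      have := perm_sum_sq_lt i j hi hj σ hσ
      rw [← hq σ, h, hq1] at this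
      exact lt_irrefl _ this
    · simp
  · intro b hb hne
    rw [hcoeff] at hb
    obtain ⟨σ, _, hσ⟩ := Finset.exists_ne_zero_of_sum_ne_zero hb
    have hb' : (∑ k, Finsupp.single (⟨i (σ k) + j k, hn _ _⟩ : Fin n) 1) = b := by
      by_contra h
      rw [if_neg h, mul_zero] at hσ
      exact hσ rfl
    by_cases h1 : σ = 1
    · subst h1
      exact absurd hb'.symm hne
    · rw [← hb', hq, hq1]
      exact perm_sum_sq_lt i j hi hj σ h1


theorem chain_or_cover (m : ℕ) : ∀ A : Finset ℕ,
    (∃ a : Fin (m + 1) → ℕ, (∀ k, a k ∈ A) ∧ ∀ k l, k < l → a k + 2 ≤ a l) ∨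
    (∃ b : Fin m → ℕ, ∀ k ∈ A, ∃ i, k = b i ∨ k = b i + 1) := by
  induction m with
  | zero =>
    intro A
    rcases A.eq_empty_or_nonempty with rfl | ⟨x, hx⟩
    · right
      exact ⟨fun _ => 0, by simp⟩
    · left
      refine ⟨fun _ => x, fun _ => hx, fun k l h => ?_⟩
      exact absurd h (by omega)
  | succ m ih =>
    intro A
    rcases A.eq_empty_or_nonempty with rfl | hne
    · right
      exact ⟨fun _ => 0, by simp⟩
    · have hmin : ∀ k ∈ A, A.min' hne ≤ k := fun k hk => A.min'_le k hk
      have hmem := A.min'_mem hne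
      generalize A.min' hne = x at hmin hmem
      rcases ih (A.filter fun k => x + 2 ≤ k) with ⟨a, ha, hgap⟩ | ⟨b, hb⟩
      · left
        refine ⟨Fin.cons x a, fun k => ?_, fun k l hkl => ?_⟩
        · refine Fin.cases ?_ (fun k => ?_) k
          · simpa using hmem
          · simpa using (Finset.mem_filter.1 (ha k)).1
        · revert hkl
          refine Fin.cases ?_ (fun l => ?_) l
          · intro h
            exact absurd h (Fin.not_lt_zero _)
          · refine Fin.cases ?_ (fun k => ?_) k
            · intro _
              simpa using (Finset.mem_filter.1 (ha l)).2
            · intro h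
              simpa using hgap k l (by simpa using h)
      · right
        refine ⟨Fin.cons x b, fun k hk => ?_⟩
        by_cases h2 : x + 2 ≤ k
        · obtain ⟨i, hi⟩ := hb k (Finset.mem_filter.2 ⟨hk, h2⟩)
          exact ⟨i.succ, by simpa using hi⟩
        · refine ⟨0, ?_⟩
          have := hmin k hk
          simp only [Fin.cons_zero]
          omega

/-- Standard exponents: the support is covered by `m` pairs of consecutive indices. -/
def Std (m : ℕ) (α : Fin n →₀ ℕ) : Prop :=
  ∃ b : Fin m → ℕ, ∀ k : Fin n, α k ≠ 0 → ∃ i, (k : ℕ) = b i ∨ (k : ℕ) = b i + 1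

theorem exists_chain_of_not_std {m : ℕ} {α : Fin n →₀ ℕ} (h : ¬ Std m α) :
    ∃ a : Fin (m + 1) → Fin n, (∀ k, α (a k) ≠ 0) ∧ ∀ k l, k < l → (a k : ℕ) + 2 ≤ a l := by
  rcases chain_or_cover m (α.support.map Fin.valEmbedding) with ⟨a, ha, hgap⟩ | ⟨b, hb⟩
  · have : ∀ k, ∃ x : Fin n, α x ≠ 0 ∧ (x : ℕ) = a k := by
      intro k
      obtain ⟨x, hx, hxa⟩ := Finset.mem_map.1 (ha k)
      exact ⟨x, Finsupp.mem_support_iff.1 hx, hxa⟩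
    choose c hc hca using this
    exact ⟨c, hc, fun k l hkl => by rw [hca, hca]; exact hgap k l hkl⟩
  · exact absurd ⟨b, fun k hk => hb k (Finset.mem_map.2 ⟨k, Finsupp.mem_support_iff.2 hk, rfl⟩)⟩ h

theorem HasLead.monomial (a : Fin n →₀ ℕ) : HasLead (MvPolynomial.monomial a (1 : K)) a := by
  classical
  refine ⟨by simp, fun b hb hne => ?_⟩
  rw [coeff_monomial] at hb
  exact absurd (by simpa using hb) (Ne.symm hne)

theorem gap_bounds {m N : ℕ} (a : Fin (m + 1) → ℕ) (hgap : ∀ k l, k < l → a k + 2 ≤ a l)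
    (hN : ∀ k, a k < N) : (∀ k : Fin (m + 1), 2 * (k : ℕ) ≤ a k) ∧ ∀ k : Fin (m + 1), a k + 2 * (m - (k : ℕ)) < N := by
  constructor
  · intro k
    induction k using Fin.induction with
    | zero => simp
    | succ i ih =>
      have := hgap i.castSucc i.succ (Fin.castSucc_lt_succ)
      simp at ih ⊢
      omega
  · intro k
    induction k using Fin.reverseInduction with
    | last => simpa using hN _
    | cast i ih =>
      have := hgap i.castSucc i.succ (Fin.castSucc_lt_succ)
      have := i.isLt
      simp at ih ⊢
      omega

theorem exists_minor {r s m : ℕ} (hr : m + 1 ≤ r) (hs : m + 1 ≤ s)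
    (a : Fin (m + 1) → Fin (r + s - 1)) (hgap : ∀ k l, k < l → (a k : ℕ) + 2 ≤ a l) :
    ∃ g ∈ minorsIdeal (m + 1) (hankelGen K r s), HasLead g (∑ k, Finsupp.single (a k) 1) := by
  obtain ⟨h1, h2⟩ := gap_bounds (fun k => (a k : ℕ)) hgap (fun k => (a k).isLt)
  let i : Fin (m + 1) → ℕ := fun k => max (k : ℕ) ((a k : ℕ) - (s - 1 - m + k))
  let j : Fin (m + 1) → ℕ := fun k => min ((a k : ℕ) - k) (s - 1 - m + k)
  have hij : ∀ k, i k + j k = a k := by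
    intro k; have := h1 k; simp only [i, j]; omega
  have hir : ∀ k, i k < r := by
    intro k; have := h2 k; have := k.isLt; simp only [i]; omega
  have hjs : ∀ k, j k < s := by
    intro k; have := k.isLt; simp only [j]; omega
  have hi : StrictMono i := by
    rw [Fin.strictMono_iff_lt_succ]
    intro k
    have := hgap k.castSucc k.succ Fin.castSucc_lt_succ
    have h3 := h1 k.castSucc
    simp only [i, Fin.val_castSucc, Fin.val_succ] at h3 ⊢
    omega
  have hj : StrictMono j := by
    rw [Fin.strictMono_iff_lt_succ]
    intro k
    have := hgap k.castSucc k.succ Fin.castSucc_lt_succ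
    have h3 := h1 k.castSucc
    simp only [j, Fin.val_castSucc, Fin.val_succ] at h3 ⊢
    omega
  have hn : ∀ k l, i k + j l < r + s - 1 := by
    intro k l; have := hir k; have := hjs l; omega
  refine ⟨_, Ideal.subset_span ⟨fun k => ⟨i k, hir k⟩, fun k => ⟨j k, hjs k⟩, fun k l h => hi h,
    fun k l h => hj h, rfl⟩, ?_⟩
  have := hasLead_det (K := K) i j hi hj hn
  convert this using 1
  · congr 1
    ext1 k l
    simp only [Matrix.submatrix_apply, hankelGen, Matrix.of_apply]
    rw [xv_of_lt (hn k l)]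
  · refine Finset.sum_congr rfl fun k _ => ?_
    congr 1
    exact Fin.ext (hij k).symm

theorem exists_lead_of_not_std {r s m : ℕ} (hr : m + 1 ≤ r) (hs : m + 1 ≤ s)
    (α : Fin (r + s - 1) →₀ ℕ) (h : ¬ Std m α) :
    ∃ g ∈ minorsIdeal (m + 1) (hankelGen K r s), HasLead g α := by
  classical
  obtain ⟨a, ha, hgap⟩ := exists_chain_of_not_std h
  obtain ⟨g, hg, hl⟩ := exists_minor (K := K) hr hs a hgap
  have hle : (∑ k, Finsupp.single (a k) 1) ≤ α := by
    intro x
    rw [Finsupp.finsetSum_apply]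
    simp only [Finsupp.single_apply]
    by_cases hx : ∃ k, a k = x
    · obtain ⟨k, rfl⟩ := hx
      rw [Finset.sum_eq_single k]
      · simpa using Nat.one_le_iff_ne_zero.2 (ha k)
      · intro l _ hl
        rw [if_neg]
        intro he
        rcases lt_or_gt_of_ne hl with h | h
        · have := hgap _ _ h; rw [he] at this; omega
        · have := hgap _ _ h; rw [he] at this; omega
      · simp
    · rw [Finset.sum_eq_zero]
      · exact Nat.zero_le _
      · intro k _
        rw [if_neg]
        exact fun h => hx ⟨k, h⟩
  refine ⟨g * MvPolynomial.monomial (α - ∑ k, Finsupp.single (a k) 1) 1,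
    Ideal.mul_mem_right _ _ hg, ?_⟩
  have := hl.mul (HasLead.monomial (K := K) (α - ∑ k, Finsupp.single (a k) 1))
  rwa [add_tsub_cancel_of_le hle] at this

/-- Polynomials supported on standard exponents. -/
def stdPoly (n m : ℕ) (K : Type*) [Field K] : Submodule K (MvPolynomial (Fin n) K) where
  carrier := {g | ∀ α, coeff α g ≠ 0 → Std m α}
  zero_mem' := by intro α h; simp at h
  add_mem' := by
    intro g h hg hh α hα
    by_cases h1 : coeff α g = 0
    · refine hh α fun h2 => hα ?_
      rw [coeff_add, h1, h2, add_zero]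
    · exact hg α h1
  smul_mem' := by
    intro c g hg α hα
    refine hg α fun h => hα ?_
    rw [coeff_smul, h, smul_zero]

theorem straighten {m : ℕ} (I : Ideal (MvPolynomial (Fin n) K))
    (hI : ∀ α, ¬ Std m α → ∃ g ∈ I, HasLead g α) (g : MvPolynomial (Fin n) K) :
    ∃ g', g - g' ∈ I ∧ g' ∈ stdPoly n m K := by
  classical
  let W : Submodule K (MvPolynomial (Fin n) K) := I.restrictScalars K ⊔ stdPoly n m K
  have hmon : ∀ N, ∀ α : Fin n →₀ ℕ, qw α = N → MvPolynomial.monomial α (1 : K) ∈ W := by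
    intro N
    induction N using Nat.strong_induction_on with
    | _ N ih =>
      intro α hα
      by_cases hs : Std m α
      · refine Submodule.mem_sup_right ?_
        intro β hβ
        rw [coeff_monomial] at hβ
        have : α = β := by simpa using hβ
        rwa [← this]
      · obtain ⟨f, hf, hl⟩ := hI α hs
        have e : MvPolynomial.monomial α (1 : K) = f - (f - MvPolynomial.monomial α 1) := by ring
        rw [e]
        refine Submodule.sub_mem _ (Submodule.mem_sup_left hf) ?_
        rw [MvPolynomial.as_sum (f - MvPolynomial.monomial α (1 : K))]
        refine Submodule.sum_mem _ fun β hβ => ?_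
        have hβ' := mem_support_iff.1 hβ
        rw [coeff_sub, coeff_monomial] at hβ'
        have hne : β ≠ α := by
          rintro rfl
          rw [hl.1] at hβ'
          simp at hβ'
        rw [if_neg (Ne.symm hne), sub_zero] at hβ'
        have := ih (qw β) (hα ▸ hl.2 β hβ' hne) β rfl
        rw [show MvPolynomial.monomial β (coeff β (f - MvPolynomial.monomial α 1))
          = (coeff β (f - MvPolynomial.monomial α 1)) • MvPolynomial.monomial β (1 : K) by
            rw [smul_monomial, smul_eq_mul, mul_one]]
        exact Submodule.smul_mem _ _ this
  have hg : g ∈ W := by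
    rw [g.as_sum]
    refine Submodule.sum_mem _ fun β _ => ?_
    rw [show MvPolynomial.monomial β (coeff β g) = (coeff β g) • MvPolynomial.monomial β (1 : K) by
            rw [smul_monomial, smul_eq_mul, mul_one]]
    exact Submodule.smul_mem _ _ (hmon _ β rfl)
  obtain ⟨x, hx, y, hy, rfl⟩ := Submodule.mem_sup.1 hg
  exact ⟨y, by simpa using hx, hy⟩


section Counting

variable {m : ℕ}

theorem energy {E : Type*} [Fintype E] (κ : E → ℕ) (c : E → Fin m) (b : Fin m → ℕ) :
    ∑ e, ((κ e : ℤ) - b (c e)) * ((κ e : ℤ) - b (c e) - 1)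
      = ((∑ e, κ e ^ 2 : ℕ) : ℤ)
        - ∑ i, (2 * (b i : ℤ) + 1) * ((∑ e, if c e = i then κ e else 0 : ℕ) : ℤ)
        + ∑ i, ((b i : ℤ) ^ 2 + b i) * ((∑ e, if c e = i then 1 else 0 : ℕ) : ℤ) := by
  push_cast
  simp only [Finset.mul_sum]
  rw [Finset.sum_comm (γ := Fin m), Finset.sum_comm (γ := Fin m),
    ← Finset.sum_sub_distrib, ← Finset.sum_add_distrib]
  refine Finset.sum_congr rfl fun e _ => ?_
  simp only [mul_ite, mul_zero, Finset.sum_ite_eq, Finset.mem_univ, if_true]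
  ring

theorem energy_term_nonneg (x b : ℤ) : 0 ≤ (x - b) * (x - b - 1) := by
  rcases le_or_gt x b with h | h
  · exact mul_nonneg_of_nonpos_of_nonpos (by omega) (by omega)
  · exact mul_nonneg (by omega) (by omega)

theorem count_formula {E : Type*} [Fintype E] (κ : E → ℕ) (c : E → Fin m) (b : Fin m → ℕ)
    (hb : ∀ e, κ e = b (c e) ∨ κ e = b (c e) + 1) (i : Fin m) (k : ℕ) :
    ((∑ e, if c e = i ∧ κ e = k then 1 else 0 : ℕ) : ℤ)
      = if k = b i + 1 then
          ((∑ e, if c e = i then κ e else 0 : ℕ) : ℤ)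
            - b i * ((∑ e, if c e = i then 1 else 0 : ℕ) : ℤ)
        else if k = b i then
          ((∑ e, if c e = i then 1 else 0 : ℕ) : ℤ) * (1 + b i)
            - ((∑ e, if c e = i then κ e else 0 : ℕ) : ℤ)
        else 0 := by
  push_cast
  split_ifs with h1 h2
  · rw [Finset.mul_sum, ← Finset.sum_sub_distrib]
    refine Finset.sum_congr rfl fun e _ => ?_
    by_cases hc : c e = i
    · rcases hb e with h | h <;> rw [hc] at h <;> simp [hc, h, h1]
    · simp [hc]
  · rw [Finset.sum_mul, ← Finset.sum_sub_distrib]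
    refine Finset.sum_congr rfl fun e _ => ?_
    by_cases hc : c e = i
    · rcases hb e with h | h <;> rw [hc] at h <;> simp [hc, h, h2] <;> ring
    · simp [hc]
  · refine Finset.sum_eq_zero fun e _ => ?_
    rw [if_neg]
    rintro ⟨hc, hk⟩
    have := hb e
    rw [hc, hk] at this
    tauto

/-- index type for the factors of a monomial -/
abbrev Fac (β : Fin n →₀ ℕ) : Type := Σ k : Fin n, Fin (β k)

theorem qw_eq_fac (β : Fin n →₀ ℕ) : qw β = ∑ e : Fac β, (e.1 : ℕ) ^ 2 := by
  rw [Fintype.sum_sigma]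
  simp [qw]

theorem fac_count (β : Fin n →₀ ℕ) (c : Fac β → Fin m) (k : Fin n) :
    β k = ∑ i, ∑ e : Fac β, if c e = i ∧ (e.1 : ℕ) = k then 1 else 0 := by
  rw [Finset.sum_comm]
  have : ∀ e : Fac β, (∑ i, if c e = i ∧ (e.1 : ℕ) = k then 1 else 0)
      = if e.1 = k then 1 else 0 := by
    intro e
    by_cases h : e.1 = k
    · simp [h]
    · have h' : ¬ (e.1 : ℕ) = k := fun h' => h (Fin.ext h')
      simp [h, h']
  simp only [this]
  rw [Fintype.sum_sigma, Finset.sum_eq_single k]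
  · simp
  · intro l _ hl
    simp [hl]
  · simp

/-- The exponent of the image monomial determined by a colouring of the factors. -/
noncomputable def dat (β : Fin n →₀ ℕ) (c : Fac β → Fin m) : (Fin m ⊕ Fin m) →₀ ℕ :=
  ∑ e : Fac β, (Finsupp.single (Sum.inl (c e)) 1 + Finsupp.single (Sum.inr (c e)) (e.1 : ℕ))

theorem dat_inl (β : Fin n →₀ ℕ) (c : Fac β → Fin m) (i : Fin m) :
    dat β c (Sum.inl i) = ∑ e, if c e = i then 1 else 0 := by
  simp [dat, Finsupp.finsetSum_apply, Finsupp.single_apply]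

theorem dat_inr (β : Fin n →₀ ℕ) (c : Fac β → Fin m) (i : Fin m) :
    dat β c (Sum.inr i) = ∑ e : Fac β, if c e = i then (e.1 : ℕ) else 0 := by
  simp [dat, Finsupp.finsetSum_apply, Finsupp.single_apply]

/-- generic sums of geometric sequences -/
noncomputable def psi (n m : ℕ) (K : Type*) [Field K] :
    MvPolynomial (Fin n) K →ₐ[K] MvPolynomial (Fin m ⊕ Fin m) K :=
  aeval fun k => ∑ i, X (Sum.inl i) * X (Sum.inr i) ^ (k : ℕ)

theorem psi_monomial (β : Fin n →₀ ℕ) (a : K) :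
    psi n m K (monomial β a) = ∑ c : Fac β → Fin m, monomial (dat β c) a := by
  classical
  have h1 : psi n m K (monomial β a)
      = C a * ∏ e : Fac β, ∑ i, X (Sum.inl i) * X (Sum.inr i) ^ (e.1 : ℕ) := by
    rw [psi, aeval_monomial, Fintype.prod_sigma, Finsupp.prod_fintype _ _ (by simp)]
    simp [algebraMap_eq]
  rw [h1, Finset.prod_univ_sum, Finset.mul_sum]
  simp only [Fintype.piFinset_univ]
  refine Finset.sum_congr rfl fun c _ => ?_
  have h2 : monomial (dat β c) a = C a * monomial (dat β c) (1 : K) := by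
    rw [C_mul_monomial, mul_one]
  rw [h2, dat, monomial_sum_one]
  congr 1
  refine Finset.prod_congr rfl fun e _ => ?_
  rw [← mul_one (1 : K), ← monomial_mul, X_pow_eq_monomial]
  simp [X]

theorem psi_inj_std (g : MvPolynomial (Fin n) K) (hg : g ∈ stdPoly n m K)
    (h0 : psi n m K g = 0) : g = 0 := by
  classical
  by_contra hne
  obtain ⟨α, hα, hmax⟩ := Finset.exists_max_image g.support qw (support_nonempty.2 hne)
  have hα' := mem_support_iff.1 hα
  obtain ⟨b, hb⟩ := hg α hα'
  choose γ hγ using hb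
  have hfac : ∀ e : Fac α, α e.1 ≠ 0 := fun e h => by
    have := e.2.isLt
    omega
  let c : Fac α → Fin m := fun e => γ e.1 (hfac e)
  have hc : ∀ e e' : Fac α, e.1 = e'.1 → c e = c e' := by
    rintro ⟨k, x⟩ ⟨k', x'⟩ h
    simp only at h
    subst h
    rfl
  have hbal : ∀ e : Fac α, (e.1 : ℕ) = b (c e) ∨ (e.1 : ℕ) = b (c e) + 1 := fun e => hγ _ _
  -- comparison
  have hcmp : ∀ β ∈ g.support, ∀ c' : Fac β → Fin m, dat β c' = dat α c →
      (∀ e : Fac β, (e.1 : ℕ) = b (c' e) ∨ (e.1 : ℕ) = b (c' e) + 1) ∧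
      ∀ (i : Fin m) (k : ℕ), (∑ e : Fac β, if c' e = i ∧ (e.1 : ℕ) = k then 1 else 0)
        = ∑ e : Fac α, if c e = i ∧ (e.1 : ℕ) = k then 1 else 0 := by
    intro β hβ c' hdat
    have hd : ∀ i, (∑ e : Fac β, if c' e = i then 1 else 0) = ∑ e : Fac α, if c e = i then 1 else 0 := by
      intro i
      rw [← dat_inl, ← dat_inl, hdat]
    have hw : ∀ i, (∑ e : Fac β, if c' e = i then (e.1 : ℕ) else 0)
        = ∑ e : Fac α, if c e = i then (e.1 : ℕ) else 0 := by
      intro i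
      rw [← dat_inr, ← dat_inr, hdat]
    have e1 := energy (fun e : Fac β => (e.1 : ℕ)) c' b
    have e2 := energy (fun e : Fac α => (e.1 : ℕ)) c b
    simp only [hd, hw, ← qw_eq_fac] at e1
    simp only [← qw_eq_fac] at e2
    have e3 : ∑ e : Fac α, (((e.1 : ℕ) : ℤ) - b (c e)) * (((e.1 : ℕ) : ℤ) - b (c e) - 1) = 0 := by
      refine Finset.sum_eq_zero fun e _ => ?_
      rcases hbal e with h | h <;> rw [h] <;> simp
    have hq : (qw β : ℤ) ≤ qw α := by exact_mod_cast hmax β hβ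
    have e4 : ∑ e : Fac β, (((e.1 : ℕ) : ℤ) - b (c' e)) * (((e.1 : ℕ) : ℤ) - b (c' e) - 1) = 0 := by
      apply le_antisymm
      · linarith
      · exact Finset.sum_nonneg fun e _ => energy_term_nonneg _ _
    have hbal' : ∀ e : Fac β, (e.1 : ℕ) = b (c' e) ∨ (e.1 : ℕ) = b (c' e) + 1 := by
      intro e
      have := (Finset.sum_eq_zero_iff_of_nonneg fun e _ => energy_term_nonneg _ _).1 e4 e
        (Finset.mem_univ _)
      rcases mul_eq_zero.1 this with h | h
      · left; omega
      · right; omega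
    refine ⟨hbal', fun i k => ?_⟩
    have f1 := count_formula (fun e : Fac β => (e.1 : ℕ)) c' b hbal' i k
    have f2 := count_formula (fun e : Fac α => (e.1 : ℕ)) c b hbal i k
    simp only [hd, hw] at f1
    rw [← f2] at f1
    exact_mod_cast f1
  have hcoef := congrArg (coeff (dat α c)) h0
  rw [g.as_sum, map_sum, coeff_sum, coeff_zero, Finset.sum_eq_single α] at hcoef
  · rw [psi_monomial, coeff_sum, Finset.sum_eq_single c] at hcoef
    · rw [coeff_monomial, if_pos rfl] at hcoef
      exact hα' hcoef
    · intro c' _ hne'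
      rw [coeff_monomial, if_neg]
      intro hdat
      apply hne'
      funext e
      have hN := (hcmp α hα c' hdat).2 (c' e) e.1
      have hpos : (∑ e' : Fac α, if c' e' = c' e ∧ (e'.1 : ℕ) = e.1 then 1 else 0) ≠ 0 := by
        intro hz
        have := Finset.sum_eq_zero_iff.1 hz e (Finset.mem_univ _)
        simp at this
      rw [hN] at hpos
      obtain ⟨e', _, he'⟩ := Finset.exists_ne_zero_of_sum_ne_zero hpos
      have he2 : c e' = c' e ∧ (e'.1 : ℕ) = e.1 := by
        by_contra h
        exact he' (if_neg h)
      rw [← he2.1]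
      exact hc e' e (Fin.ext he2.2)
    · simp
  · intro β hβ hβα
    rw [psi_monomial, coeff_sum]
    refine Finset.sum_eq_zero fun c' _ => ?_
    rw [coeff_monomial, if_neg]
    intro hdat
    apply hβα
    ext k
    rw [fac_count β c' k, fac_count α c k]
    exact Finset.sum_congr rfl fun i _ => (hcmp β hβ c' hdat).2 i k
  · intro h
    exact absurd hα h

end Counting


section LocalAlgebra

variable {R : Type*} [CommRing R]

theorem det_mem_pow {m d : ℕ} (J : Ideal R) (A : Matrix (Fin (m + d)) (Fin (m + d)) R)
    (hA : ∀ (i : Fin d) j, A (Fin.natAdd m i) j ∈ J) : A.det ∈ J ^ d := by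
  rw [← Matrix.det_transpose, Matrix.det_apply']
  refine Ideal.sum_mem _ fun σ _ => Ideal.mul_mem_left _ _ ?_
  rw [Fin.prod_univ_add]
  refine Ideal.mul_mem_left _ _ ?_
  have : ∏ i : Fin d, A.transpose (σ (Fin.natAdd m i)) (Fin.natAdd m i) ∈ ∏ _i : Fin d, J :=
    Ideal.prod_mem_prod fun i _ => hA _ _
  simpa using this

/-- error of the linear recurrence -/
def err {m : ℕ} (x : ℕ → R) (c : Fin m → R) (k : ℕ) : R := x (k + m) - ∑ i, c i * x (k + i)

theorem hankel_det_mem {m d n o : ℕ} (x : ℕ → R) (c : Fin m → R) (J : Ideal R)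
    (hJ : ∀ k, k + m < n → err x c k ∈ J)
    (hn : ∀ k l : Fin (m + d), (k : ℕ) + l + o < n) :
    (Matrix.of fun k l : Fin (m + d) => x ((k : ℕ) + l + o)).det ∈ J ^ d := by
  classical
  set A : Matrix (Fin (m + d)) (Fin (m + d)) R := Matrix.of fun k l => x ((k : ℕ) + l + o) with hA
  let U : Matrix (Fin (m + d)) (Fin (m + d)) R := Matrix.of fun k l =>
    (if k = l then 1 else 0) - ∑ i : Fin m, if m ≤ (k : ℕ) ∧ (k : ℕ) - m + i = l then c i else 0
  have hU : U.det = 1 := by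
    have htri : U.BlockTriangular OrderDual.toDual := by
      intro k l hkl
      have hkl' : (k : ℕ) < l := hkl
      simp only [U, Matrix.of_apply]
      rw [if_neg (by intro h; rw [h] at hkl'; exact lt_irrefl _ hkl'), Finset.sum_eq_zero, sub_zero]
      intro i _
      rw [if_neg]
      rintro ⟨h1, h2⟩
      have := i.isLt
      omega
    rw [Matrix.det_of_isLowerTriangular _ htri]
    refine Finset.prod_eq_one fun k _ => ?_
    simp only [U, Matrix.of_apply, if_true]
    rw [Finset.sum_eq_zero, sub_zero]
    intro i _
    rw [if_neg]
    rintro ⟨h1, h2⟩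
    have := i.isLt
    omega
  have hdet : A.det = (U * A).det := by rw [Matrix.det_mul, hU, one_mul]
  rw [hdet]
  refine det_mem_pow J _ fun i j => ?_
  have hent : (U * A) (Fin.natAdd m i) j = err x c ((i : ℕ) + j + o) := by
    rw [Matrix.mul_apply]
    simp only [U, Matrix.of_apply, sub_mul, Finset.sum_sub_distrib, ite_mul, one_mul, zero_mul,
      Finset.sum_ite_eq, Finset.mem_univ, if_true, Finset.sum_mul]
    rw [Finset.sum_comm]
    simp only [err, hA, Matrix.of_apply, Fin.val_natAdd]
    congr 1
    · congr 1; omega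
    · refine Finset.sum_congr rfl fun l _ => ?_
      rw [Finset.sum_eq_single (⟨(i : ℕ) + l, by have := i.isLt; have := l.isLt; omega⟩ : Fin (m + d))]
      · rw [if_pos ⟨by omega, by simp⟩]
        congr 2
        simp only
        omega
      · intro y _ hy
        rw [if_neg]
        rintro ⟨_, h2⟩
        apply hy
        apply Fin.ext
        simp only
        omega
      · simp
  rw [hent]
  apply hJ
  have := hn (Fin.natAdd m i) j
  simp only [Fin.val_natAdd] at this
  omega

theorem exists_combo {m n : ℕ} (x : ℕ → R) (c : Fin m → R) (J : Ideal R)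
    (hJ : ∀ k, k + m < n → err x c k ∈ J) (i : ℕ) :
    ∃ v : Fin m → R, ∀ j, i + j < n → x (i + j) - ∑ l, v l * x (l + j) ∈ J := by
  classical
  induction i using Nat.strong_induction_on with
  | _ i ih =>
    by_cases hi : i < m
    · refine ⟨Pi.single ⟨i, hi⟩ 1, fun j _ => ?_⟩
      rw [Finset.sum_eq_single ⟨i, hi⟩]
      · simp
      · intro b _ hb
        simp [hb]
      · simp
    · have : ∀ l : Fin m, ∃ v : Fin m → R, ∀ j, i - m + l + j < n →
          x (i - m + l + j) - ∑ l', v l' * x (l' + j) ∈ J := fun l =>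
        ih _ (by have := l.isLt; omega)
      choose v hv using this
      refine ⟨fun l' => ∑ l, c l * v l l', fun j hj => ?_⟩
      have h1 := hJ (i - m + j) (by omega)
      have h2 : ∑ l, c l * (x (i - m + l + j) - ∑ l', v l l' * x (l' + j)) ∈ J :=
        Ideal.sum_mem _ fun l _ => Ideal.mul_mem_left _ _ (hv l j (by have := l.isLt; omega))
      have h3 := Ideal.add_mem _ h1 h2
      convert h3 using 1
      simp only [err, mul_sub, Finset.sum_sub_distrib, Finset.sum_mul, Finset.mul_sum]
      rw [Finset.sum_comm]
      have e1 : i - m + j + m = i + j := by omega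
      have e2 : ∀ l : Fin m, i - m + j + (l : ℕ) = i - m + l + j := fun l => by omega
      simp only [e1, e2, mul_assoc]
      ring

theorem det_mul_eq_zero {m : ℕ} (V : Matrix (Fin (m + 1)) (Fin m) R)
    (W : Matrix (Fin m) (Fin (m + 1)) R) : (V * W).det = 0 := by
  let V' : Matrix (Fin (m + 1)) (Fin (m + 1)) R :=
    Matrix.of fun i => Fin.snoc (α := fun _ => R) (V i) 0
  let W' : Matrix (Fin (m + 1)) (Fin (m + 1)) R :=
    Matrix.of fun l k => Fin.snoc (α := fun _ => R) (fun l => W l k) 0 l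
  have : V * W = V' * W' := by
    ext i j
    rw [Matrix.mul_apply, Matrix.mul_apply, Fin.sum_univ_castSucc]
    simp [V', W']
  rw [this, Matrix.det_mul, Matrix.det_eq_zero_of_column_eq_zero (Fin.last m), zero_mul]
  intro i
  simp [V']

theorem minor_mem {m n : ℕ} (x : ℕ → R) (c : Fin m → R) (J : Ideal R)
    (hJ : ∀ k, k + m < n → err x c k ∈ J) (i j : Fin (m + 1) → ℕ)
    (hn : ∀ k l, i k + j l < n) :
    (Matrix.of fun k l => x (i k + j l)).det ∈ J := by
  have := fun k => exists_combo x c J hJ (i k)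
  choose v hv using this
  rw [← Ideal.Quotient.eq_zero_iff_mem, RingHom.map_det]
  have h : (Ideal.Quotient.mk J).mapMatrix (Matrix.of fun k l => x (i k + j l))
      = (Matrix.of fun k l => Ideal.Quotient.mk J (v k l)) *
        (Matrix.of fun (l : Fin m) k => Ideal.Quotient.mk J (x (l + j k))) := by
    ext k l
    rw [Matrix.mul_apply]
    simp only [RingHom.mapMatrix_apply, Matrix.map_apply, Matrix.of_apply]
    simp only [← map_mul, ← map_sum]
    exact Ideal.Quotient.eq.2 (hv k (j l) (hn k l))
  rw [h, det_mul_eq_zero]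

theorem pigeonhole {h p : ℕ} (hp : 0 < p) (g : Fin h → R) (y : R)
    (hy : y ∈ Ideal.span (Set.range g) ^ (h * (p - 1) + 1)) :
    y ∈ Ideal.span (Set.range fun i => g i ^ p) := by
  rw [Ideal.mem_span_pow_iff_exists_isHomogeneous] at hy
  obtain ⟨q, hq, rfl⟩ := hy
  rw [q.as_sum, map_sum]
  refine Ideal.sum_mem _ fun b hb => ?_
  rw [eval_monomial]
  refine Ideal.mul_mem_left _ _ ?_
  have hdeg : ∑ i, b i = h * (p - 1) + 1 := by
    have := hq (mem_support_iff.1 hb)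
    rw [Finsupp.weight_apply, Finsupp.sum_fintype _ _ (by simp)] at this
    simpa using this
  have : ∃ i, p ≤ b i := by
    by_contra hcon
    push Not at hcon
    have : ∑ i, b i ≤ ∑ _i : Fin h, (p - 1) := Finset.sum_le_sum fun i _ => by
      have := hcon i; omega
    simp at this
    omega
  obtain ⟨i, hi⟩ := this
  rw [Finsupp.prod_fintype _ _ (by simp)]
  refine Ideal.mem_of_dvd _ ?_ (Ideal.subset_span ⟨i, rfl⟩)
  exact (pow_dvd_pow _ hi).trans (Finset.dvd_prod_of_mem (fun i => g i ^ b i) (Finset.mem_univ i))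

end LocalAlgebra


section Assembly

/-- The leading principal Hankel minor of size `m`. -/
noncomputable def uu (n m : ℕ) (K : Type*) [Field K] : MvPolynomial (Fin n) K :=
  (Matrix.of fun k l : Fin m => xv n K ((k : ℕ) + l)).det

theorem psi_xv {m k : ℕ} (hk : k < n) :
    psi n m K (xv n K k) = ∑ i, X (Sum.inl i) * X (Sum.inr i) ^ k := by
  rw [xv_of_lt hk, psi, aeval_X]

theorem psi_uu_ne {m : ℕ} (hn : 2 * m ≤ n) : psi n m K (uu n m K) ≠ 0 := by
  have h : psi n m K (uu n m K) =
      ((Matrix.vandermonde fun i => (X (Sum.inr i) : MvPolynomial (Fin m ⊕ Fin m) K)).transpose *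
        Matrix.diagonal (fun i => X (Sum.inl i)) *
        Matrix.vandermonde fun i => (X (Sum.inr i) : MvPolynomial (Fin m ⊕ Fin m) K)).det := by
    rw [uu, AlgHom.map_det]
    congr 1
    ext1 k l
    rw [AlgHom.mapMatrix_apply, Matrix.map_apply, Matrix.of_apply,
      psi_xv (by have := k.isLt; have := l.isLt; omega), Matrix.mul_apply]
    refine Finset.sum_congr rfl fun i _ => ?_
    rw [Matrix.mul_diagonal, Matrix.transpose_apply, Matrix.vandermonde_apply,
      Matrix.vandermonde_apply, pow_add]
    ring
  rw [h, Matrix.det_mul, Matrix.det_mul, Matrix.det_transpose, Matrix.det_diagonal]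
  have hv : (Matrix.vandermonde fun i => (X (Sum.inr i) : MvPolynomial (Fin m ⊕ Fin m) K)).det ≠ 0 :=
    Matrix.det_vandermonde_ne_zero_iff.2 fun i j hij => by
      have := X_injective hij
      exact Sum.inr_injective this
  exact mul_ne_zero (mul_ne_zero hv (Finset.prod_ne_zero_iff.2 fun i _ => X_ne_zero _)) hv

theorem err_eq_zero_of_geom {F : Type*} [Field F] {m N : ℕ} (hmN : 2 * m ≤ N) (x : ℕ → F)
    (c y z : Fin m → F)
    (hz : Function.Injective z)
    (hx : ∀ k, k < N → x k = ∑ i, y i * z i ^ k)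
    (h0 : ∀ k, k < m → err x c k = 0) (k : ℕ) (hk : k + m < N) : err x c k = 0 := by
  have he : ∀ k, k + m < N → err x c k = ∑ l, (y l * (z l ^ m - ∑ i, c i * z l ^ (i : ℕ))) * z l ^ k := by
    intro k hk
    rw [err, hx _ hk]
    have : ∀ i : Fin m, c i * x (k + i) = ∑ l, c i * (y l * z l ^ (k + (i : ℕ))) := fun i => by
      rw [hx _ (by have := i.isLt; omega), Finset.mul_sum]
    simp only [this]
    rw [Finset.sum_comm, ← Finset.sum_sub_distrib]
    refine Finset.sum_congr rfl fun l _ => ?_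
    rw [mul_sub, sub_mul, Finset.mul_sum, Finset.sum_mul]
    congr 1
    · ring
    · exact Finset.sum_congr rfl fun i _ => by ring
  have hd : (fun l => y l * (z l ^ m - ∑ i, c i * z l ^ (i : ℕ))) = 0 := by
    apply Matrix.eq_zero_of_forall_pow_sum_mul_pow_eq_zero hz
    intro i
    rw [← h0 i i.isLt, he i (by have := i.isLt; omega)]
  rw [he k hk]
  refine Finset.sum_eq_zero fun l _ => ?_
  have := congrFun hd l
  simp only [Pi.zero_apply] at this
  rw [this, zero_mul]

theorem main_ideal {m d₁ d₂ : ℕ} (hn : n = 2 * m + d₁ + d₂) (h12 : d₂ ≤ d₁) (h21 : d₁ ≤ d₂ + 1)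
    (p : ℕ) [Fact p.Prime] [CharP K p] :
    ∃ P : Ideal (MvPolynomial (Fin n) K),
      (∀ i j : Fin (m + 1) → ℕ, (∀ k l, i k + j l < n) →
        (Matrix.of fun k l => xv n K (i k + j l)).det ∈ P) ∧
      (∀ g ∈ P, psi n m K g = 0) ∧
      (∀ Φ : MvPolynomial (Fin n) K →+ MvPolynomial (Fin n) K,
        (∀ h g, Φ (h ^ p * g) = h * Φ g) → ∀ a ∈ P,
          Φ (((Matrix.of fun k l : Fin (m + d₁) => xv n K ((k : ℕ) + l + 0)).det *
            (Matrix.of fun k l : Fin (m + d₂) => xv n K ((k : ℕ) + l + 1)).det) ^ (p - 1) * a)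
              ∈ P) := by
  classical
  have hp : 0 < p := (Fact.out : p.Prime).pos
  let u := uu n m K
  let R := Localization.Away u
  let ι : MvPolynomial (Fin n) K →+* R := algebraMap _ R
  have hu : IsUnit (ι u) := IsLocalization.Away.algebraMap_isUnit u
  let x : ℕ → R := fun k => ι (xv n K k)
  let H : Matrix (Fin m) (Fin m) R := Matrix.of fun k l => x ((k : ℕ) + l)
  have hH : IsUnit H.det := by
    have : H.det = ι u := by
      simp only [u, uu]
      rw [RingHom.map_det]
      rfl
    rw [this]
    exact hu
  let c : Fin m → R := H⁻¹.mulVec fun j : Fin m => x ((j : ℕ) + m)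
  have hc : H.mulVec c = fun j : Fin m => x ((j : ℕ) + m) := by
    simp only [c]
    rw [Matrix.mulVec_mulVec, Matrix.mul_nonsing_inv _ hH, Matrix.one_mulVec]
  have he0 : ∀ k, k < m → err x c k = 0 := by
    intro k hk
    have := congrFun hc ⟨k, hk⟩
    rw [err, ← this, sub_eq_zero]
    simp only [Matrix.mulVec, dotProduct, H, Matrix.of_apply]
    exact Finset.sum_congr rfl fun i _ => mul_comm _ _
  let g : Fin (d₁ + d₂) → R := fun j => err x c (m + j)
  let J : Ideal R := Ideal.span (Set.range g)
  have hJ : ∀ k, k + m < n → err x c k ∈ J := by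
    intro k hk
    by_cases hkm : k < m
    · rw [he0 k hkm]
      exact J.zero_mem
    · refine Ideal.subset_span ⟨⟨k - m, by omega⟩, ?_⟩
      simp only [g]
      congr 1
      omega
  let P : Ideal (MvPolynomial (Fin n) K) := J.comap ι
  have hmap : ∀ {d : ℕ} (i j : Fin d → ℕ) (o : ℕ),
      ι (Matrix.of fun k l => xv n K (i k + j l + o)).det
        = (Matrix.of fun k l => x (i k + j l + o)).det := by
    intro d i j o
    rw [RingHom.map_det]
    rfl
  refine ⟨P, ?_, ?_, ?_⟩
  · intro i j hij
    rw [Ideal.mem_comap]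
    have := hmap i j 0
    simp only [add_zero] at this
    rw [this]
    exact minor_mem x c J hJ i j hij
  · intro y hy
    let T := MvPolynomial (Fin m ⊕ Fin m) K
    let F := FractionRing T
    let ψ : MvPolynomial (Fin n) K →+* F := (algebraMap T F).comp (psi n m K : _ →+* T)
    have hinj : Function.Injective (algebraMap T F) := IsFractionRing.injective T F
    have hψu : IsUnit (ψ u) := by
      rw [isUnit_iff_ne_zero]
      intro h
      exact psi_uu_ne (K := K) (n := n) (m := m) (by omega) (hinj (by rw [map_zero]; exact h))
    let L : R →+* F := IsLocalization.Away.lift u hψu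
    have hL : ∀ s, L (ι s) = ψ s := fun s => IsLocalization.Away.lift_eq u hψu s
    have herr : ∀ k, L (err x c k) = err (fun k => L (x k)) (fun i => L (c i)) k := by
      intro k
      simp [err]
    have hzero : ∀ k, k + m < n → L (err x c k) = 0 := by
      intro k hk
      rw [herr]
      refine err_eq_zero_of_geom (N := n) (by omega) _ _
        (fun i => algebraMap T F (X (Sum.inl i))) (fun i => algebraMap T F (X (Sum.inr i)))
        ?_ ?_ ?_ k hk
      · intro i j hij
        exact Sum.inr_injective (X_injective (R := K) (hinj hij))
      · intro k hk
        simp only [x]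
        rw [hL]
        change algebraMap T F (psi n m K (xv n K k)) = _
        rw [psi_xv hk]
        simp
      · intro k hk
        rw [← herr, he0 k hk, map_zero]
    have hJL : J ≤ RingHom.ker L := by
      refine Ideal.span_le.2 ?_
      rintro _ ⟨j, rfl⟩
      exact hzero _ (by have := j.isLt; omega)
    have : L (ι y) = 0 := hJL hy
    rw [hL] at this
    exact hinj (by rw [map_zero]; exact this)
  · intro Φ hΦ a ha
    set f := (Matrix.of fun k l : Fin (m + d₁) => xv n K ((k : ℕ) + l + 0)).det *
            (Matrix.of fun k l : Fin (m + d₂) => xv n K ((k : ℕ) + l + 1)).det with hf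
    have hfJ : ι f ∈ J ^ (d₁ + d₂) := by
      rw [hf, map_mul, pow_add]
      refine Ideal.mul_mem_mul ?_ ?_
      · rw [hmap (fun k : Fin (m + d₁) => (k : ℕ)) (fun k : Fin (m + d₁) => (k : ℕ)) 0]
        exact hankel_det_mem x c J hJ fun k l => by
          have := k.isLt; have := l.isLt; omega
      · rw [hmap (fun k : Fin (m + d₂) => (k : ℕ)) (fun k : Fin (m + d₂) => (k : ℕ)) 1]
        exact hankel_det_mem x c J hJ fun k l => by
          have := k.isLt; have := l.isLt; omega
    have hfa : ι (f ^ (p - 1) * a) ∈ J ^ ((d₁ + d₂) * (p - 1) + 1) := by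
      rw [map_mul, map_pow, pow_succ, pow_mul]
      exact Ideal.mul_mem_mul (Ideal.pow_mem_pow hfJ _) ha
    have hpig := pigeonhole hp g _ hfa
    let Q : Ideal (MvPolynomial (Fin n) K) := Ideal.span {w | ∃ v ∈ P, w = v ^ p}
    have hQ : ∀ s ∈ Q, ∀ r, Φ (r * s) ∈ P := by
      intro s hs
      induction hs using Submodule.span_induction with
      | mem s hs =>
        intro r
        obtain ⟨v, hv, rfl⟩ := hs
        rw [mul_comm, hΦ]
        exact P.mul_mem_right _ hv
      | zero => intro r; rw [mul_zero, map_zero]; exact P.zero_mem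
      | add s s' _ _ h h' => intro r; rw [mul_add, map_add]; exact P.add_mem (h r) (h' r)
      | smul r' s hs h => intro r; rw [smul_eq_mul, ← mul_assoc]; exact h _
    have hgQ : Ideal.span (Set.range fun i => g i ^ p) ≤ Q.map ι := by
      refine Ideal.span_le.2 ?_
      rintro _ ⟨i, rfl⟩
      obtain ⟨⟨G, w⟩, hG⟩ := IsLocalization.surj (Submonoid.powers u) (g i)
      simp only at hG
      have hGP : G ∈ P := by
        rw [Ideal.mem_comap]
        change algebraMap _ R G ∈ J
        rw [← hG]
        exact J.mul_mem_right _ (Ideal.subset_span ⟨i, rfl⟩)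
      have hw : IsUnit (ι w) := IsLocalization.map_units R w
      have h1 : (ι w) ^ p * g i ^ p ∈ Q.map ι := by
        have : (ι w) ^ p * g i ^ p = ι (G ^ p) := by
          rw [map_pow, ← mul_pow, mul_comm]
          exact congrArg (· ^ p) hG
        rw [this]
        exact Ideal.mem_map_of_mem _ (Ideal.subset_span ⟨G, hGP, rfl⟩)
      exact (Ideal.unit_mul_mem_iff_mem _ (hw.pow p)).1 h1
    have hmem := hgQ hpig
    obtain ⟨w, hw, hwQ⟩ := (IsLocalization.algebraMap_mem_map_algebraMap_iff
      (Submonoid.powers u) R Q _).1 hmem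
    have h2 : w ^ p * (f ^ (p - 1) * a) ∈ Q := by
      have : w ^ p = w ^ (p - 1) * w := by rw [← pow_succ, Nat.sub_add_cancel hp]
      rw [this, mul_assoc]
      exact Q.mul_mem_left _ hwQ
    have h3 := hQ _ h2 1
    rw [one_mul, hΦ, Ideal.mem_comap, map_mul] at h3
    exact (Ideal.unit_mul_mem_iff_mem _ (IsLocalization.map_units R ⟨w, hw⟩)).1 h3

end Assembly


section Final

theorem hasLead_f {m d₁ d₂ : ℕ} (hn : n = 2 * m + d₁ + d₂) (h12 : d₂ ≤ d₁) (h21 : d₁ ≤ d₂ + 1) :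
    HasLead (((Matrix.of fun k l : Fin (m + d₁) => xv n K ((k : ℕ) + l + 0)).det *
            (Matrix.of fun k l : Fin (m + d₂) => xv n K ((k : ℕ) + l + 1)).det))
      (Finsupp.equivFunOnFinite.symm fun _ => 1) := by
  classical
  have hA := hasLead_det (n := n) (K := K) (fun k : Fin (m + d₁) => (k : ℕ))
    (fun k => (k : ℕ) + 0) (fun a b h => h) (fun a b h => by simpa using h)
    (fun k l => by have := k.isLt; have := l.isLt; omega)
  have hB := hasLead_det (n := n) (K := K) (fun k : Fin (m + d₂) => (k : ℕ))
    (fun k => (k : ℕ) + 1) (fun a b h => h) (fun a b h => by simpa using h)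
    (fun k l => by have := k.isLt; have := l.isLt; omega)
  have hAB := hA.mul hB
  simp only [← add_assoc] at hAB
  convert hAB using 1
  ext x
  rw [Finsupp.add_apply, Finsupp.finsetSum_apply, Finsupp.finsetSum_apply]
  simp only [Finsupp.single_apply, Finsupp.equivFunOnFinite_symm_apply_apply, Fin.ext_iff]
  have hx := x.isLt
  rcases Nat.even_or_odd' (x : ℕ) with ⟨y, hy | hy⟩
  · rw [Finset.sum_eq_single (⟨y, by omega⟩ : Fin (m + d₁)), Finset.sum_eq_zero]
    · rw [if_pos (by simp only; omega), add_zero]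
    · intro k _
      rw [if_neg (by omega)]
    · intro k _ hk
      rw [if_neg]
      intro h
      exact hk (Fin.ext (by simp only; omega))
    · simp
  · rw [Finset.sum_eq_zero, Finset.sum_eq_single (⟨y, by omega⟩ : Fin (m + d₂))]
    · rw [if_pos (by simp only; omega)]
    · intro k _ hk
      rw [if_neg]
      intro h
      exact hk (Fin.ext (by simp only; omega))
    · simp
    · intro k _
      rw [if_neg (by omega)]

theorem trace_lead (p : ℕ) (σ : K →+ K) (hσ1 : σ 1 = 1)
    (Φ : MvPolynomial (Fin n) K →+ MvPolynomial (Fin n) K)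
    (hΦ : ∀ g b, coeff b (Φ g) = σ (coeff (shiftExp p b) g)) (hp : 0 < p)
    (f : MvPolynomial (Fin n) K)
    (hf : HasLead f (Finsupp.equivFunOnFinite.symm fun _ => 1)) : Φ (f ^ (p - 1)) = 1 := by
  classical
  have h := hf.pow (p - 1)
  have h0 : (p - 1) • (Finsupp.equivFunOnFinite.symm fun _ => 1) = shiftExp p (0 : Fin n →₀ ℕ) := by
    ext i
    simp [shiftExp_apply]
  rw [h0] at h
  ext b
  rw [hΦ, coeff_one]
  split_ifs with hb
  · rw [← hb, h.1, hσ1]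
  · have : coeff (shiftExp p b) (f ^ (p - 1)) = 0 := by
      by_contra hne
      have hlt := h.2 _ hne fun he => hb (shiftExp_injective hp he).symm
      have : qw (shiftExp p b) = qw (p • b) + qw (shiftExp p (0 : Fin n →₀ ℕ)) := by
        rw [← qw_add]
        congr 1
        simp [shiftExp]
      omega
    rw [this, map_zero]

theorem split_quotient {S : Type*} [CommRing S] (I : Ideal S) (p : ℕ) (φ : S →+ S)
    (hφ : ∀ h g, φ (h ^ p * g) = h * φ g) (h1 : φ 1 = 1) (hI : ∀ a ∈ I, φ a ∈ I)
    [ExpChar (S ⧸ I) p] : IsPureRingHom (frobenius (S ⧸ I) p) := by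
  have hwd : ∀ s s', Ideal.Quotient.mk I s = Ideal.Quotient.mk I s' →
      Ideal.Quotient.mk I (φ s) = Ideal.Quotient.mk I (φ s') := by
    intro s s' h
    rw [Ideal.Quotient.eq] at h ⊢
    rw [← map_sub]
    exact hI _ h
  have hsurj : Function.Surjective (Ideal.Quotient.mk I) := Ideal.Quotient.mk_surjective
  let τ0 : S ⧸ I → S ⧸ I := fun x => Ideal.Quotient.mk I (φ (Function.surjInv hsurj x))
  have hτ0 : ∀ s, τ0 (Ideal.Quotient.mk I s) = Ideal.Quotient.mk I (φ s) := fun s =>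
    hwd _ _ (Function.surjInv_eq hsurj _)
  let τ : S ⧸ I →+ S ⧸ I := AddMonoidHom.mk' τ0 (by
    intro a b
    obtain ⟨a, rfl⟩ := hsurj a
    obtain ⟨b, rfl⟩ := hsurj b
    rw [← map_add, hτ0, hτ0, hτ0, map_add, map_add])
  refine isPure_of_split _ τ ?_ ?_
  · intro a b
    obtain ⟨a, rfl⟩ := hsurj a
    obtain ⟨b, rfl⟩ := hsurj b
    change τ0 _ = _ * τ0 _
    rw [frobenius_def, ← map_pow, ← map_mul, hτ0, hτ0, hφ, map_mul]
  · change τ0 1 = 1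
    rw [← map_one (Ideal.Quotient.mk I), hτ0, h1]

theorem Fpure_succ (p : ℕ) [Fact p.Prime] [CharP K p]
    (r s m : ℕ) (hr : m + 1 ≤ r) (hs : m + 1 ≤ s)
    [ExpChar (MvPolynomial (Fin (r + s - 1)) K ⧸ minorsIdeal (m + 1) (hankelGen K r s)) p] :
    IsPureRingHom (frobenius
      (MvPolynomial (Fin (r + s - 1)) K ⧸ minorsIdeal (m + 1) (hankelGen K r s)) p) := by
  have hp : 0 < p := (Fact.out : p.Prime).pos
  have hd0 : r + s - 1 = 2 * m + ((r + s - 1 + 1) / 2 - m) + ((r + s - 1) / 2 - m) := by omega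
  have hd1 : (r + s - 1) / 2 - m ≤ (r + s - 1 + 1) / 2 - m := by omega
  have hd2 : (r + s - 1 + 1) / 2 - m ≤ (r + s - 1) / 2 - m + 1 := by omega
  obtain ⟨P, hP1, hP2, hP3⟩ := main_ideal (K := K) hd0 hd1 hd2 p
  have hf := hasLead_f (K := K) hd0 hd1 hd2
  obtain ⟨f, hf, hP3⟩ : ∃ f : MvPolynomial (Fin (r + s - 1)) K,
      HasLead f (Finsupp.equivFunOnFinite.symm fun _ => 1) ∧
      ∀ Φ : MvPolynomial (Fin (r + s - 1)) K →+ MvPolynomial (Fin (r + s - 1)) K,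
        (∀ h g, Φ (h ^ p * g) = h * Φ g) → ∀ a ∈ P, Φ (f ^ (p - 1) * a) ∈ P := ⟨_, hf, hP3⟩
  have hIP : minorsIdeal (m + 1) (hankelGen K r s) ≤ P := by
    refine Ideal.span_le.2 ?_
    rintro _ ⟨ρ, γ, _, _, rfl⟩
    have hlt : ∀ k l, (ρ k : ℕ) + (γ l : ℕ) < r + s - 1 := by
      intro k l
      have := (ρ k).isLt
      have := (γ l).isLt
      omega
    have := hP1 (fun k => (ρ k : ℕ)) (fun k => (γ k : ℕ)) hlt
    have hM : (hankelGen K r s).submatrix ρ γ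
        = Matrix.of fun k l => xv (r + s - 1) K ((ρ k : ℕ) + (γ l : ℕ)) := by
      ext1 k l
      simp only [Matrix.submatrix_apply, hankelGen, Matrix.of_apply]
      rw [xv_of_lt (hlt k l)]
    rw [hM]
    exact this
  have hPI : P ≤ minorsIdeal (m + 1) (hankelGen K r s) := by
    intro g hg
    obtain ⟨g', hgg, hstd⟩ := straighten (m := m) (minorsIdeal (m + 1) (hankelGen K r s))
      (fun α hα => exists_lead_of_not_std hr hs α hα) g
    have h1 := hP2 _ (hIP hgg)
    rw [map_sub, hP2 g hg, zero_sub, neg_eq_zero] at h1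
    rw [psi_inj_std g' hstd h1, sub_zero] at hgg
    exact hgg
  obtain ⟨σ, hσ, hσ1⟩ := exists_field_split K p
  obtain ⟨Φ, hΦc, hΦ⟩ := exists_trace (ι := Fin (r + s - 1)) p σ hσ
  refine split_quotient _ p (Φ.comp (AddMonoidHom.mulLeft (f ^ (p - 1)))) ?_ ?_ ?_
  · intro h g
    simp only [AddMonoidHom.comp_apply, AddMonoidHom.coe_mulLeft]
    rw [mul_left_comm, hΦ]
  · simp only [AddMonoidHom.comp_apply, AddMonoidHom.coe_mulLeft, mul_one]
    exact trace_lead p σ hσ1 Φ hΦc hp f hf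
  · intro a ha
    exact hPI (hP3 Φ hΦ a (hIP ha))

end Final

end HankelFP

/-- **Corollary 3.4(b).** If `K` is a field of characteristic `p > 0` and `H` is the generic
`r × s` Hankel matrix, then for every `t ≤ min(r,s)` the determinantal ring `S/I_t(H)` is
F-pure, i.e. its Frobenius endomorphism is a pure ring homomorphism. -/
theorem hankel_determinantal_Fpure {K : Type*} [Field K] (p : ℕ) [Fact p.Prime] [CharP K p]
    (r s t : ℕ) (ht : t ≤ min r s)
    [ExpChar (MvPolynomial (Fin (r + s - 1)) K ⧸ minorsIdeal t (hankelGen K r s)) p] :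
    IsPureRingHom
      (frobenius (MvPolynomial (Fin (r + s - 1)) K ⧸ minorsIdeal t (hankelGen K r s)) p) := by
  rcases t with _ | m
  · have htop : minorsIdeal 0 (hankelGen K r s) = ⊤ := by
      rw [Ideal.eq_top_iff_one]
      exact Ideal.subset_span ⟨Fin.elim0, Fin.elim0, fun a => a.elim0, fun a => a.elim0, by simp⟩
    have hsub : Subsingleton
        (MvPolynomial (Fin (r + s - 1)) K ⧸ minorsIdeal 0 (hankelGen K r s)) :=
      Ideal.Quotient.subsingleton_iff.2 htop
    exact HankelFP.isPure_of_split _ 0 (fun _ _ => Subsingleton.elim _ _) (Subsingleton.elim _ _)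
  · exact HankelFP.Fpure_succ p r s m (ht.trans (min_le_left _ _)) (ht.trans (min_le_right _ _))
end

section
/- Let K be a field, n = 2m−1, S = K[x₁,…,xₙ], let X be the m×m generic Hankel matrix with entries x₁,…,xₙ, P₁ the matrix obtained by dropping the last row of X, P₂ the matrix obtained by dropping the first column of X, and Q the matrix obtained by dropping both. Then for every t with 2 ≤ t ≤ m one has the primary decomposition I_t(X) + I_{t−1}(Q) = I_{t−1}(P₁) ∩ I_{t−1}(P₂). -/
section SquareHankel

variable (K : Type*) [Field K] (m : ℕ)

/-- `X` : the generic `m × m` Hankel matrix with entries `x₁, …, x_{2m-1}`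
(zero-indexed: entry `(i,j)` is `X (i+j)`). -/
noncomputable def hankelX : Matrix (Fin m) (Fin m) (MvPolynomial (Fin (2 * m - 1)) K) :=
  fun i j => MvPolynomial.X ⟨i.1 + j.1, by have := i.isLt; have := j.isLt; omega⟩

/-- `P₁` : the `(m-1) × m` Hankel matrix obtained from `X` by dropping the last row. -/
noncomputable def hankelP1 : Matrix (Fin (m - 1)) (Fin m) (MvPolynomial (Fin (2 * m - 1)) K) :=
  fun i j => MvPolynomial.X ⟨i.1 + j.1, by have := i.isLt; have := j.isLt; omega⟩

/-- `P₂` : the `m × (m-1)` Hankel matrix obtained from `X` by dropping the first column. -/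
noncomputable def hankelP2 : Matrix (Fin m) (Fin (m - 1)) (MvPolynomial (Fin (2 * m - 1)) K) :=
  fun i j => MvPolynomial.X ⟨i.1 + j.1 + 1, by have := i.isLt; have := j.isLt; omega⟩

/-- `Q` : the `(m-1) × (m-1)` Hankel matrix obtained from `X` by dropping the last row and
the first column. -/
noncomputable def hankelQ :
    Matrix (Fin (m - 1)) (Fin (m - 1)) (MvPolynomial (Fin (2 * m - 1)) K) :=
  fun i j => MvPolynomial.X ⟨i.1 + j.1 + 1, by have := i.isLt; have := j.isLt; omega⟩

end SquareHankel

/-- a sparse chain of length `s` inside the set `A` -/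
def SparseChain (A : Set ℕ) (s : ℕ) (c : ℕ → ℕ) : Prop :=
  (∀ i, i < s → c i ∈ A) ∧ ∀ i j, i < j → j < s → c i + 2 ≤ c j

lemma sparse_greedy (s : ℕ) : ∀ A : Finset ℕ, (∃ c, SparseChain (A : Set ℕ) s c) ∨
    ∃ E : Finset ℕ, E ⊆ A ∧ E.card < s ∧ (∀ a ∈ E, ∀ b ∈ E, a < b → a + 2 ≤ b) ∧
      ∀ a ∈ A, ∃ k ∈ E, a = k ∨ a = k + 1 := by
  induction s with
  | zero =>
    intro A
    left
    exact ⟨fun _ => 0, by intro i hi; omega, by intro i j _ hj; omega⟩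
  | succ s ih =>
    intro A
    rcases A.eq_empty_or_nonempty with rfl | hA
    · right
      exact ⟨∅, by simp, by simp, by simp, by simp⟩
    · set k := A.min' hA with hk
      have hkA : k ∈ A := A.min'_mem hA
      have hmin : ∀ a ∈ A, k ≤ a := fun a ha => A.min'_le a ha
      rcases ih (A.filter (fun a => k + 2 ≤ a)) with ⟨c, hc1, hc2⟩ | ⟨E, hE1, hE2, hE3, hE4⟩
      · left
        refine ⟨fun i => Nat.casesOn i k c, ?_, ?_⟩
        · intro i hi
          cases i with
          | zero => exact hkA
          | succ i =>
            have := hc1 i (by omega)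
            simp only [Finset.coe_filter, Set.mem_ofPred_eq] at this
            exact this.1
        · intro i j hij hj
          cases j with
          | zero => omega
          | succ j =>
            cases i with
            | zero =>
              have := hc1 j (by omega)
              simp only [Finset.coe_filter, Set.mem_ofPred_eq] at this
              exact this.2
            | succ i => exact hc2 i j (by omega) (by omega)
      · right
        have hE1' : ∀ a ∈ E, a ∈ A ∧ k + 2 ≤ a := fun a ha => by
          have := hE1 ha
          simpa using this
        refine ⟨insert k E, ?_, ?_, ?_, ?_⟩
        · intro a ha
          rcases Finset.mem_insert.1 ha with rfl | ha
          · exact hkA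
          · exact (hE1' a ha).1
        · have := Finset.card_insert_le k E
          omega
        · intro a ha b hb hab
          rcases Finset.mem_insert.1 ha with h | ha <;> rcases Finset.mem_insert.1 hb with h' | hb
          · omega
          · have := (hE1' b hb).2
            omega
          · have := (hE1' a ha).2
            omega
          · exact hE3 a ha b hb hab
        · intro a ha
          by_cases h : k + 2 ≤ a
          · obtain ⟨l, hl, hl'⟩ := hE4 a (by simp [ha, h])
            exact ⟨l, Finset.mem_insert_of_mem hl, hl'⟩
          · have := hmin a ha
            exact ⟨k, Finset.mem_insert_self _ _, by omega⟩

lemma sparse_exchange (A : Set ℕ) (N s M : ℕ) (hs : 1 ≤ s) (hN : N = 2 * M) (c d : ℕ → ℕ)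
    (hc : SparseChain {a | a ∈ A ∧ a < N} s c)
    (hd : SparseChain {a | a ∈ A ∧ 1 ≤ a ∧ a ≤ N} s d) :
    (∃ e, SparseChain {a | a ∈ A ∧ 1 ≤ a ∧ a < N} s e) ∨
    (∃ e, SparseChain {a | a ∈ A ∧ a ≤ N} (s + 1) e) := by
  by_contra hcon
  push Not at hcon
  obtain ⟨h1, h2⟩ := hcon
  obtain ⟨hcA, hcg⟩ := hc
  obtain ⟨hdA, hdg⟩ := hd
  simp only [Set.mem_ofPred_eq] at hcA hdA
  have key1 : ∀ i, i < s → c i < d i := by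
    intro i hi
    by_contra hle
    push Not at hle
    refine h1 (fun j => if j ≤ i then d j else c j) ⟨?_, ?_⟩
    · intro j hj
      have a1 := hcA j hj
      have a2 := hdA j hj
      have a3 := hcA i hi
      have a4 := hdA i hi
      by_cases h : j ≤ i
      · simp only [h, if_true, Set.mem_ofPred_eq]
        refine ⟨a2.1, a2.2.1, ?_⟩
        rcases eq_or_lt_of_le h with rfl | h'
        · omega
        · have := hdg j i h' hi
          omega
      · simp only [h, if_false, Set.mem_ofPred_eq]
        have := hcg i j (by omega) hj
        exact ⟨a1.1, by omega, a1.2⟩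
    · intro j k hjk hk
      have b1 := hcg j k hjk hk
      have b2 := hdg j k hjk hk
      have b3 := hdA j (by omega)
      by_cases h : j ≤ i <;> by_cases h' : k ≤ i
      · simpa [h, h'] using b2
      · simp only [h, h', if_true, if_false]
        have b4 := hcg i k (by omega) hk
        rcases eq_or_lt_of_le h with rfl | h''
        · omega
        · have := hdg j i h'' hi
          omega
      · omega
      · simpa [h, h'] using b1
  have key2 : ∀ i, i < s → d i < c i + 2 := by
    intro i hi
    by_contra hle
    push Not at hle
    refine h2 (fun j => if j ≤ i then c j else d (j - 1)) ⟨?_, ?_⟩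
    · intro j hj
      by_cases h : j ≤ i
      · have a1 := hcA j (by omega)
        simp only [h, if_true, Set.mem_ofPred_eq]
        exact ⟨a1.1, by omega⟩
      · have a1 := hdA (j - 1) (by omega)
        simp only [h, if_false, Set.mem_ofPred_eq]
        exact ⟨a1.1, by omega⟩
    · intro j k hjk hk
      by_cases h : j ≤ i <;> by_cases h' : k ≤ i
      · simpa [h, h'] using hcg j k hjk (by omega)
      · simp only [h, h', if_true, if_false]
        have b1 : c j ≤ c i := by
          rcases eq_or_lt_of_le h with rfl | h''
          · exact le_rfl
          · have := hcg j i h'' hi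
            omega
        have b2 : d i ≤ d (k - 1) := by
          have : i ≤ k - 1 := by omega
          rcases eq_or_lt_of_le this with h3 | h3
          · rw [← h3]
          · have := hdg i (k - 1) h3 (by omega)
            omega
        omega
      · omega
      · simp only [h, h', if_false]
        exact hdg (j - 1) (k - 1) (by omega) (by omega)
  have key3 : ∀ i, i + 1 < s → c (i + 1) = c i + 2 := by
    intro i hi
    have g := hcg i (i + 1) (by omega) hi
    by_contra hne
    refine h1 (fun j => if j ≤ i then d j else c j) ⟨?_, ?_⟩
    · intro j hj
      have a1 := hcA j hj
      have a2 := hdA j hj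
      have a3 := hcA (i + 1) hi
      have a4 := key2 i (by omega)
      have a5 := key1 j hj
      by_cases h : j ≤ i
      · simp only [h, if_true, Set.mem_ofPred_eq]
        refine ⟨a2.1, a2.2.1, ?_⟩
        rcases eq_or_lt_of_le h with rfl | h'
        · omega
        · have := hdg j i h' (by omega)
          omega
      · simp only [h, if_false, Set.mem_ofPred_eq]
        have := hcg i j (by omega) hj
        exact ⟨a1.1, by omega, a1.2⟩
    · intro j k hjk hk
      have b1 := hcg j k hjk hk
      have b2 := hdg j k hjk hk
      by_cases h : j ≤ i <;> by_cases h' : k ≤ i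
      · simpa [h, h'] using b2
      · simp only [h, h', if_true, if_false]
        have b4 : c (i + 1) ≤ c k := by
          have : i + 1 ≤ k := by omega
          rcases eq_or_lt_of_le this with h3 | h3
          · rw [← h3]
          · have := hcg (i + 1) k h3 (by omega)
            omega
        have b5 : d j ≤ d i := by
          rcases eq_or_lt_of_le h with rfl | h''
          · exact le_rfl
          · have := hdg j i h'' (by omega)
            omega
        have a4 := key2 i (by omega)
        omega
      · omega
      · simpa [h, h'] using b1
  have c0 : c 0 = 0 := by
    by_contra h0
    refine h1 c ⟨?_, hcg⟩
    intro i hi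
    have a1 := hcA i hi
    refine ⟨a1.1, ?_, a1.2⟩
    rcases Nat.eq_zero_or_pos i with rfl | h
    · omega
    · have := hcg 0 i h hi
      omega
  have dl : d (s - 1) = N := by
    by_contra h0
    refine h1 d ⟨?_, hdg⟩
    intro i hi
    have a1 := hdA i hi
    have a2 := hdA (s - 1) (by omega)
    refine ⟨a1.1, a1.2.1, ?_⟩
    rcases eq_or_lt_of_le (show i ≤ s - 1 by omega) with rfl | h
    · omega
    · have := hdg i (s - 1) h (by omega)
      omega
  have cs : ∀ i, i < s → c i = 2 * i := by
    intro i
    induction i with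
    | zero => intro _; exact c0
    | succ i ih =>
      intro hi
      rw [key3 i hi, ih (by omega)]
      ring
  have e1 := cs (s - 1) (by omega)
  have e2 := key1 (s - 1) (by omega)
  have e3 := key2 (s - 1) (by omega)
  omega

lemma det_eq_zero_of_factor {R : Type*} [CommRing R] [IsDomain R] {s : ℕ} {E : Type*} [Fintype E]
    (hE : Fintype.card E < s) (U : Matrix (Fin s) E R) (V : Matrix E (Fin s) R) :
    (U * V).det = 0 := by
  apply IsFractionRing.injective R (FractionRing R)
  rw [map_zero, RingHom.map_det, RingHom.mapMatrix_apply, Matrix.map_mul]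
  by_contra h
  have h1 := Matrix.rank_of_isUnit _ ((Matrix.isUnit_iff_isUnit_det _).2 (Ne.isUnit h))
  have h2 := Matrix.rank_mul_le_left (U.map (algebraMap R (FractionRing R)))
    (V.map (algebraMap R (FractionRing R)))
  have h3 := Matrix.rank_le_card_width (U.map (algebraMap R (FractionRing R)))
  rw [h1, Fintype.card_fin] at h2
  omega

/-- the weight of a monomial, for the strictly convex weight `i ↦ n(n+1) + i²` -/
def sqWt (n : ℕ) (v : Fin n →₀ ℕ) : ℕ := ∑ i, v i * (n * (n + 1) + (i : ℕ) ^ 2)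

lemma sqWt_add (n : ℕ) (u v : Fin n →₀ ℕ) : sqWt n (u + v) = sqWt n u + sqWt n v := by
  simp [sqWt, add_mul, Finset.sum_add_distrib]

lemma sqWt_single (n : ℕ) (i : Fin n) :
    sqWt n (Finsupp.single i 1) = n * (n + 1) + (i : ℕ) ^ 2 := by
  simp [sqWt, Finsupp.single_apply]

lemma sqWt_sum (n : ℕ) {ι : Type*} (t : Finset ι) (f : ι → Fin n →₀ ℕ) :
    sqWt n (∑ i ∈ t, f i) = ∑ i ∈ t, sqWt n (f i) := by
  classical
  induction t using Finset.induction_on with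
  | empty => simp [sqWt]
  | insert a t ha ih => rw [Finset.sum_insert ha, Finset.sum_insert ha, sqWt_add, ih]

lemma perm_sq_lt {s : ℕ} (ρ γ : Fin s → ℕ) (hρ : StrictMono ρ) (hγ : StrictMono γ) (o : ℕ)
    (σ : Equiv.Perm (Fin s)) (hσ : σ ≠ 1) :
    ∑ i, (ρ (σ i) + γ i + o) ^ 2 < ∑ i, (ρ i + γ i + o) ^ 2 := by
  have hmv : Monovary γ ρ := by
    intro i j h
    exact (hγ (hρ.lt_iff_lt.1 h)).le
  have h1 : ∑ i, γ i * ρ (σ i) < ∑ i, γ i * ρ i := by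
    rw [hmv.sum_mul_comp_perm_lt_sum_mul_iff]
    intro h
    apply hσ
    have hm : StrictMono (fun i => σ.symm i) := by
      intro a b hab
      have := @h (σ.symm a) (σ.symm b) (by simpa using hρ hab)
      have h2 := hγ.le_iff_le.1 this
      exact lt_of_le_of_ne h2 (fun e => hab.ne (σ.symm.injective e))
    have hm' : StrictMono (fun i => σ i) := by
      intro a b hab
      by_contra hcc
      push Not at hcc
      have := hm.monotone hcc
      simp at this
      omega
    have h3 : ∀ i, σ i = i := by
      intro i
      have h4 := Subsingleton.elim (hm'.orderIsoOfSurjective _ σ.surjective) (OrderIso.refl _)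
      have := congrArg (fun e => e i) h4
      simpa using this
    ext i
    simp [h3 i]
  have h2 : ∑ i, (ρ (σ i)) ^ 2 = ∑ i, (ρ i) ^ 2 := Equiv.sum_comp σ (fun i => ρ i ^ 2)
  have h3 : ∑ i, (ρ (σ i)) = ∑ i, (ρ i) := Equiv.sum_comp σ (fun i => ρ i)
  have e : ∀ a b : ℕ, (a + b + o) ^ 2 = a ^ 2 + (b + o) ^ 2 + 2 * (b * a) + 2 * o * a := by
    intro a b; ring
  simp only [e, Finset.sum_add_distrib, ← Finset.mul_sum, h2, h3]
  omega

/-- polynomials all of whose monomials have weight `< W` -/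
noncomputable abbrev lowWt (K : Type*) [Field K] (n W : ℕ) : Submodule K (MvPolynomial (Fin n) K) :=
  MvPolynomial.restrictSupport K {v | sqWt n v < W}

lemma minor_lead {K : Type*} [Field K] (n s : ℕ) (ρ γ : Fin s → ℕ) (hρ : StrictMono ρ)
    (hγ : StrictMono γ) (o : ℕ) (hlt : ∀ i j, ρ i + γ j + o < n) (u : Fin n →₀ ℕ)
    (hu : ∀ i, u ⟨ρ i + γ i + o, hlt i i⟩ ≠ 0) :
    ∃ q : MvPolynomial (Fin n) K, MvPolynomial.monomial u 1 - q * Matrix.det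
      (Matrix.of fun i j => MvPolynomial.X ⟨ρ i + γ j + o, hlt i j⟩ :
        Matrix (Fin s) (Fin s) (MvPolynomial (Fin n) K)) ∈ lowWt K n (sqWt n u) := by
  classical
  let dg : Equiv.Perm (Fin s) → (Fin n →₀ ℕ) := fun σ =>
    ∑ i, Finsupp.single (⟨ρ (σ i) + γ i + o, hlt _ _⟩ : Fin n) 1
  have hinj : Function.Injective (fun i : Fin s => (⟨ρ i + γ i + o, hlt i i⟩ : Fin n)) := by
    intro i j h
    have h' : ρ i + γ i + o = ρ j + γ j + o := congrArg Fin.val h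
    have hm : StrictMono (fun i => ρ i + γ i) := hρ.add hγ
    exact hm.injective (show ρ i + γ i = ρ j + γ j by omega)
  have hle : dg 1 ≤ u := by
    intro a
    simp only [dg, Finsupp.coe_finsetSum, Finset.sum_apply, Equiv.Perm.one_apply]
    by_cases h : ∃ i, (⟨ρ i + γ i + o, hlt i i⟩ : Fin n) = a
    · obtain ⟨i, rfl⟩ := h
      rw [Finset.sum_eq_single i]
      · have := hu i
        simp
        omega
      · intro b _ hb
        rw [Finsupp.single_apply, if_neg]
        intro h
        exact hb (hinj h)
      · simp
    · push Not at h
      rw [Finset.sum_eq_zero]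
      · omega
      · intro i _
        rw [Finsupp.single_apply, if_neg (h i)]
  have hwt : ∀ σ, σ ≠ 1 → sqWt n (dg σ) < sqWt n (dg 1) := by
    intro σ hσ
    have := perm_sq_lt ρ γ hρ hγ o σ hσ
    simp only [dg, sqWt_sum, sqWt_single, Finset.sum_add_distrib, Equiv.Perm.one_apply]
    omega
  have hprod : ∀ σ : Equiv.Perm (Fin s),
      ∏ i, (MvPolynomial.X ⟨ρ (σ i) + γ i + o, hlt _ _⟩ : MvPolynomial (Fin n) K) =
        MvPolynomial.monomial (dg σ) 1 := by
    intro σ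
    simp only [dg, MvPolynomial.X]
    rw [MvPolynomial.monomial_sum_one]
  refine ⟨MvPolynomial.monomial (u - dg 1) 1, ?_⟩
  rw [Matrix.det_apply', ← Finset.add_sum_erase _ _ (Finset.mem_univ 1)]
  simp only [Matrix.of_apply, hprod]
  rw [mul_add, Equiv.Perm.sign_one]
  have e1 : (MvPolynomial.monomial (u - dg 1) (1 : K)) *
      ((((1 : ℤˣ) : ℤ) : MvPolynomial (Fin n) K) * MvPolynomial.monomial (dg 1) 1) =
      MvPolynomial.monomial u 1 := by
    rw [Units.val_one, Int.cast_one, one_mul, MvPolynomial.monomial_mul, one_mul,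
      tsub_add_cancel_of_le hle]
  rw [e1, sub_add_cancel_left, Finset.mul_sum]
  refine Submodule.neg_mem _ (Submodule.sum_mem _ fun σ hσ => ?_)
  have hσ' := hwt σ (Finset.ne_of_mem_erase hσ)
  have e2 : (MvPolynomial.monomial (u - dg 1) (1 : K)) *
      (((Equiv.Perm.sign σ : ℤ) : MvPolynomial (Fin n) K) * MvPolynomial.monomial (dg σ) 1) =
      MvPolynomial.monomial (u - dg 1 + dg σ) ((Equiv.Perm.sign σ : ℤ) : K) := by
    rw [mul_left_comm, MvPolynomial.monomial_mul, one_mul,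
      ← map_intCast (MvPolynomial.C : K →+* MvPolynomial (Fin n) K), MvPolynomial.C_mul_monomial,
      mul_one]
  rw [e2, MvPolynomial.monomial_mem_restrictSupport]
  left
  show sqWt n _ < sqWt n u
  conv_rhs => rw [← tsub_add_cancel_of_le hle]
  rw [sqWt_add, sqWt_add]
  omega

lemma prod_coeff_top {L : Type*} [CommRing L] {ι : Type*} (t : Finset ι)
    (y : ι → Polynomial L) (w e : ι → ℕ) (hy : ∀ i, (y i).natDegree ≤ w i) :
    (∏ i ∈ t, y i ^ e i).natDegree ≤ ∑ i ∈ t, e i * w i ∧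
    (∏ i ∈ t, y i ^ e i).coeff (∑ i ∈ t, e i * w i) = ∏ i ∈ t, ((y i).coeff (w i)) ^ e i := by
  classical
  induction t using Finset.induction_on with
  | empty => simp
  | insert a t ha ih =>
    rw [Finset.prod_insert ha, Finset.prod_insert ha, Finset.sum_insert ha]
    have h1 : (y a ^ e a).natDegree ≤ e a * w a := Polynomial.natDegree_pow_le_of_le _ (hy a)
    exact ⟨Polynomial.natDegree_mul_le_of_le h1 ih.1, by
      rw [Polynomial.coeff_mul_add_eq_of_natDegree_le h1 ih.1, ih.2,
        Polynomial.coeff_pow_of_natDegree_le (hy a)]⟩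

/-- The degenerating rank `< s` substitution. -/
lemma exists_subst (K : Type*) [Field K] (n : ℕ) (V : ℕ → Prop) [DecidablePred V]
    (E : Finset ℕ) (hEn : ∀ k ∈ E, k < n) (hE : ∀ a ∈ E, ∀ b ∈ E, a < b → a + 2 ≤ b) :
    ∃ y : ℕ → Polynomial (FractionRing (MvPolynomial ℕ K)),
      (∃ A B : ℕ → Polynomial (FractionRing (MvPolynomial ℕ K)),
        ∀ i, V i → y i = ∑ k ∈ E, A k * B k ^ i) ∧
      ∀ i, (y i).natDegree ≤ n * (n + 1) + i ^ 2 ∧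
        (y i).coeff (n * (n + 1) + i ^ 2) =
          (if V i ∧ ¬ ∃ k ∈ E, i = k ∨ i = k + 1 then 0
            else algebraMap (MvPolynomial ℕ K) (FractionRing (MvPolynomial ℕ K)) (MvPolynomial.X i)) := by
  classical
  set L := FractionRing (MvPolynomial ℕ K) with hL
  let ξ : ℕ → L := fun i => algebraMap (MvPolynomial ℕ K) L (MvPolynomial.X i)
  have hξ : ∀ i, ξ i ≠ 0 := by
    intro i h
    have := (map_eq_zero_iff _ (IsFractionRing.injective (MvPolynomial ℕ K) L)).1 h
    exact MvPolynomial.X_ne_zero i this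
  let A : ℕ → Polynomial L := fun k =>
    Polynomial.C (ξ k * (ξ k / ξ (k + 1)) ^ k) * Polynomial.X ^ (n * (n + 1) - k * (k + 1))
  let B : ℕ → Polynomial L := fun k =>
    Polynomial.C (ξ (k + 1) / ξ k) * Polynomial.X ^ (2 * k + 1)
  have hAB : ∀ k i, A k * B k ^ i =
      Polynomial.C (ξ k * (ξ k / ξ (k + 1)) ^ k * (ξ (k + 1) / ξ k) ^ i) *
        Polynomial.X ^ (n * (n + 1) - k * (k + 1) + (2 * k + 1) * i) := by
    intro k i
    simp only [A, B]
    rw [mul_pow, ← pow_mul, ← Polynomial.C_pow, pow_add]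
    simp only [Polynomial.C_mul]
    ring
  have hexp : ∀ k ∈ E, ∀ i, n * (n + 1) - k * (k + 1) + (2 * k + 1) * i ≤ n * (n + 1) + i ^ 2 ∧
      (n * (n + 1) - k * (k + 1) + (2 * k + 1) * i = n * (n + 1) + i ^ 2 → i = k ∨ i = k + 1) ∧
      (i = k ∨ i = k + 1 →
        n * (n + 1) + i ^ 2 = n * (n + 1) - k * (k + 1) + (2 * k + 1) * i) := by
    intro k hk i
    have hkn := hEn k hk
    have h1 : k * (k + 1) ≤ n * (n + 1) := Nat.mul_le_mul hkn.le (by omega)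
    obtain ⟨D, hD⟩ := Nat.exists_eq_add_of_le h1
    rw [hD, Nat.add_sub_cancel_left]
    refine ⟨?_, ?_, ?_⟩
    · rcases Nat.lt_or_ge i (k + 1) with h | h
      · obtain ⟨z, rfl⟩ := Nat.exists_eq_add_of_le (show i ≤ k by omega)
        nlinarith
      · obtain ⟨z, rfl⟩ := Nat.exists_eq_add_of_le h
        nlinarith
    · intro h
      have h2 : ((i : ℤ) - k) * (i - (k + 1)) = 0 := by
        have : ((D + (2 * k + 1) * i : ℕ) : ℤ) = ((k * (k + 1) + D + i ^ 2 : ℕ) : ℤ) := by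
          rw [h]
        push_cast at this
        linarith
      rcases mul_eq_zero.1 h2 with h3 | h3
      · left; omega
      · right; omega
    · rintro (rfl | rfl) <;> ring
  refine ⟨fun i => if V i then ∑ k ∈ E, A k * B k ^ i else
    Polynomial.C (ξ i) * Polynomial.X ^ (n * (n + 1) + i ^ 2), ⟨A, B, ?_⟩, ?_⟩
  · intro i hi
    simp [hi]
  · intro i
    by_cases hV : V i
    · simp only [hV, if_true, true_and]
      constructor
      · apply Polynomial.natDegree_sum_le_of_forall_le
        intro k hk
        rw [hAB]
        exact (Polynomial.natDegree_C_mul_X_pow_le _ _).trans (hexp k hk i).1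
      · rw [Polynomial.finsetSum_coeff]
        simp only [hAB, Polynomial.coeff_C_mul_X_pow]
        by_cases hi : ∃ k ∈ E, i = k ∨ i = k + 1
        · rw [if_neg (not_not.2 hi)]
          obtain ⟨k, hk, hik⟩ := hi
          rw [Finset.sum_eq_single_of_mem k hk]
          · rw [if_pos ((hexp k hk i).2.2 hik)]
            have h0 := hξ k
            have h1 := hξ (k + 1)
            have h2 : (ξ k / ξ (k + 1)) ^ k * (ξ (k + 1) / ξ k) ^ k = 1 := by
              rw [← mul_pow, div_mul_div_cancel₀ h1, div_self h0, one_pow]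
            rcases hik with rfl | rfl
            · rw [mul_assoc, h2, mul_one]
            · rw [pow_succ, mul_assoc, ← mul_assoc (_ ^ k), h2, one_mul, mul_div_cancel₀ _ h0]
          · intro l hl hlk
            rw [if_neg]
            intro h
            have h5 := (hexp l hl i).2.1 h.symm
            rcases Nat.lt_or_gt_of_ne hlk with h6 | h6
            · have := hE l hl k hk h6
              omega
            · have := hE k hk l hl h6
              omega
        · rw [if_pos hi]
          apply Finset.sum_eq_zero
          intro k hk
          rw [if_neg]
          intro h
          exact hi ⟨k, hk, (hexp k hk i).2.1 h.symm⟩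
    · simp only [hV, if_false, false_and]
      exact ⟨Polynomial.natDegree_C_mul_X_pow_le _ _, by simp [ξ]; rfl⟩

lemma top_chain {K : Type*} [Field K] (n s : ℕ) (V : ℕ → Prop)
    (J : Ideal (MvPolynomial (Fin n) K))
    (hJ : J ≤ Ideal.span {d | ∃ (ρ γ : Fin s → ℕ) (hlt : ∀ i j, ρ i + γ j < n),
      (∀ i j, V (ρ i + γ j)) ∧ d = Matrix.det
      (Matrix.of fun i j => MvPolynomial.X ⟨ρ i + γ j, hlt i j⟩ :
        Matrix (Fin s) (Fin s) (MvPolynomial (Fin n) K))})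
    (f : MvPolynomial (Fin n) K) (hf : f ∈ J) (u : Fin n →₀ ℕ) (hu : u ∈ f.support)
    (hmax : ∀ v ∈ f.support, sqWt n v ≤ sqWt n u) :
    ∃ c, SparseChain {a | (∃ h : a < n, u ⟨a, h⟩ ≠ 0) ∧ V a} s c := by
  classical
  let A : Finset ℕ := (Finset.univ.filter (fun i : Fin n => u i ≠ 0 ∧ V i)).image Fin.val
  have hA : ∀ a, a ∈ A ↔ (∃ h : a < n, u ⟨a, h⟩ ≠ 0) ∧ V a := by
    intro a
    simp only [A, Finset.mem_image, Finset.mem_filter, Finset.mem_univ, true_and]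
    constructor
    · rintro ⟨i, h, rfl⟩
      exact ⟨⟨i.2, h.1⟩, h.2⟩
    · rintro ⟨⟨h, h1⟩, h2⟩
      exact ⟨⟨a, h⟩, ⟨h1, h2⟩, rfl⟩
  rcases sparse_greedy s A with ⟨c, hc1, hc2⟩ | ⟨E, hE1, hE2, hE3, hE4⟩
  · exact ⟨c, fun i hi => (hA _).1 (hc1 i hi), hc2⟩
  exfalso
  obtain ⟨y, ⟨Ak, Bk, hy1⟩, hy2⟩ := exists_subst K n V E
    (fun k hk => ((hA k).1 (hE1 hk)).1.1) hE3
  set L := FractionRing (MvPolynomial ℕ K) with hL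
  let ι : K →+* L := (algebraMap (MvPolynomial ℕ K) L).comp MvPolynomial.C
  let φ : MvPolynomial (Fin n) K →+* Polynomial L :=
    MvPolynomial.eval₂Hom (Polynomial.C.comp ι) (fun i => y i)
  have hφJ : J ≤ RingHom.ker φ := by
    refine hJ.trans (Ideal.span_le.2 ?_)
    rintro d ⟨ρ, γ, hlt, hV, rfl⟩
    show φ _ = 0
    rw [RingHom.map_det, RingHom.mapMatrix_apply]
    have : Matrix.map (Matrix.of fun i j => MvPolynomial.X ⟨ρ i + γ j, hlt i j⟩ :
        Matrix (Fin s) (Fin s) (MvPolynomial (Fin n) K)) φ =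
        (Matrix.of fun i k => Ak k * Bk k ^ ρ i : Matrix (Fin s) E (Polynomial L)) *
        (Matrix.of fun k j => Bk k ^ γ j : Matrix E (Fin s) (Polynomial L)) := by
      ext1 i j
      rw [Matrix.mul_apply, Matrix.map_apply]
      simp only [φ, MvPolynomial.eval₂Hom_X', Matrix.of_apply]
      rw [hy1 _ (hV i j), ← Finset.sum_coe_sort]
      refine Finset.sum_congr rfl fun k _ => ?_
      rw [pow_add, mul_assoc]
    rw [this]
    exact det_eq_zero_of_factor (by simpa using hE2) _ _
  have h0 : φ f = 0 := hφJ hf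
  let z : ℕ → K := fun i => if V i ∧ ¬ ∃ k ∈ E, i = k ∨ i = k + 1 then 0 else 1
  have hz : ∀ i, (y i).coeff (n * (n + 1) + i ^ 2) = ι (z i) * algebraMap (MvPolynomial ℕ K) L (MvPolynomial.X i) := by
    intro i
    rw [(hy2 i).2]
    simp only [z]
    split_ifs
    · simp
    · simp; rfl
  let W := sqWt n u
  let G : MvPolynomial (Fin n) K := ∑ v ∈ f.support.filter (fun v => sqWt n v = W),
    MvPolynomial.monomial v (f.coeff v * ∏ i : Fin n, z i ^ v i)
  have hGf : algebraMap (MvPolynomial ℕ K) L (MvPolynomial.rename Fin.val G) = (φ f).coeff W := by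
    have e1 : φ f = ∑ v ∈ f.support, Polynomial.C (ι (f.coeff v)) * ∏ i : Fin n, y i ^ v i :=
      MvPolynomial.eval₂_eq' _ _ _
    rw [e1, Polynomial.finsetSum_coeff, map_sum, map_sum, Finset.sum_filter]
    refine Finset.sum_congr rfl fun v hv => ?_
    have hp := prod_coeff_top Finset.univ (fun i : Fin n => y i)
      (fun i : Fin n => n * (n + 1) + (i : ℕ) ^ 2) v (fun i => (hy2 i).1)
    change _ ≤ sqWt n v ∧ Polynomial.coeff _ (sqWt n v) = _ at hp
    rw [Polynomial.coeff_C_mul]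
    split_ifs with h
    · rw [← h, hp.2, MvPolynomial.rename_monomial, MvPolynomial.monomial_eq,
        Finsupp.prod_mapDomain_index_inj Fin.val_injective, Finsupp.prod_fintype _ _ (by simp)]
      simp only [hz, mul_pow, Finset.prod_mul_distrib, map_mul, map_prod, map_pow]
      simp only [ι, RingHom.comp_apply]
      ring
    · rw [Polynomial.coeff_eq_zero_of_natDegree_lt, mul_zero]
      exact lt_of_le_of_lt hp.1 (lt_of_le_of_ne (hmax v hv) h)
  rw [h0, Polynomial.coeff_zero,
    map_eq_zero_iff _ (IsFractionRing.injective (MvPolynomial ℕ K) L),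
    map_eq_zero_iff _ (MvPolynomial.rename_injective _ Fin.val_injective)] at hGf
  have hcu : G.coeff u = f.coeff u := by
    simp only [G, MvPolynomial.coeff_sum, MvPolynomial.coeff_monomial]
    rw [Finset.sum_ite_eq', if_pos (by simpa [W] using hu)]
    rw [Finset.prod_eq_one, mul_one]
    intro i _
    by_cases hi : u i = 0
    · rw [hi, pow_zero]
    · simp only [z]
      rw [if_neg, one_pow]
      rintro ⟨h1, h2⟩
      exact h2 (hE4 i ((hA _).2 ⟨⟨i.2, hi⟩, h1⟩))
  rw [hGf, MvPolynomial.coeff_zero] at hcu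
  exact (MvPolynomial.mem_support_iff.1 hu) hcu.symm

lemma minorsIdeal_mem {R : Type*} [CommRing R] {r s : ℕ} {t : ℕ} (M : Matrix (Fin r) (Fin s) R)
    (ρ : Fin t → Fin r) (γ : Fin t → Fin s) (hρ : StrictMono ρ) (hγ : StrictMono γ) :
    (M.submatrix ρ γ).det ∈ minorsIdeal t M :=
  Ideal.subset_span ⟨ρ, γ, hρ, hγ, rfl⟩

lemma X_le_P1 (K : Type*) [Field K] (m s : ℕ) :
    minorsIdeal (s + 1) (hankelX K m) ≤ minorsIdeal s (hankelP1 K m) := by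
  refine Ideal.span_le.2 ?_
  rintro d ⟨ρ, γ, hρ, hγ, rfl⟩
  rw [Matrix.det_succ_row _ (Fin.last s)]
  refine Ideal.sum_mem _ fun j _ => Ideal.mul_mem_left _ _ ?_
  have hlt : ∀ i : Fin s, (ρ i.castSucc : ℕ) < m - 1 := by
    intro i
    have h1 : ρ i.castSucc < ρ (Fin.last s) := hρ (Fin.castSucc_lt_last i)
    have h2 := (ρ (Fin.last s)).isLt
    have h3 : (ρ i.castSucc : ℕ) < ρ (Fin.last s) := h1
    omega
  have := minorsIdeal_mem (hankelP1 K m) (fun i : Fin s => ⟨ρ i.castSucc, hlt i⟩)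
    (fun i => γ (j.succAbove i)) (fun a b hab => hρ (show a.castSucc < b.castSucc from hab))
    (fun a b hab => hγ (Fin.strictMono_succAbove j hab))
  convert this using 2
  ext1 a b
  simp only [Matrix.submatrix_apply, Fin.succAbove_last]
  rfl

lemma X_le_P2 (K : Type*) [Field K] (m s : ℕ) :
    minorsIdeal (s + 1) (hankelX K m) ≤ minorsIdeal s (hankelP2 K m) := by
  refine Ideal.span_le.2 ?_
  rintro d ⟨ρ, γ, hρ, hγ, rfl⟩
  rw [Matrix.det_succ_column _ 0]
  refine Ideal.sum_mem _ fun j _ => Ideal.mul_mem_left _ _ ?_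
  have hpos : ∀ i : Fin s, 1 ≤ (γ i.succ : ℕ) := by
    intro i
    have h1 : γ 0 < γ i.succ := hγ (Fin.succ_pos i)
    have h3 : (γ 0 : ℕ) < γ i.succ := h1
    omega
  have := minorsIdeal_mem (hankelP2 K m) (fun i => ρ (j.succAbove i))
    (fun i : Fin s => ⟨(γ i.succ : ℕ) - 1, by
      have := hpos i
      have := (γ i.succ).isLt
      omega⟩) (fun a b hab => hρ (Fin.strictMono_succAbove j hab))
    (fun a b hab => by
      have h1 : γ a.succ < γ b.succ := hγ (Fin.succ_lt_succ_iff.2 hab)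
      have h2 : (γ a.succ : ℕ) < γ b.succ := h1
      have := hpos a
      show (γ a.succ : ℕ) - 1 < γ b.succ - 1
      omega)
  convert this using 2
  ext1 a b
  simp only [Matrix.submatrix_apply, Fin.succAbove_zero, hankelX, hankelP2]
  congr 2
  have := hpos b
  omega

lemma Q_le_P1 (K : Type*) [Field K] (m s : ℕ) :
    minorsIdeal s (hankelQ K m) ≤ minorsIdeal s (hankelP1 K m) := by
  refine Ideal.span_le.2 ?_
  rintro d ⟨ρ, γ, hρ, hγ, rfl⟩
  exact minorsIdeal_mem (hankelP1 K m) ρ (fun i => ⟨(γ i : ℕ) + 1, by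
      have := (γ i).isLt
      omega⟩) hρ (fun a b hab => Nat.succ_lt_succ (hγ hab))

lemma Q_le_P2 (K : Type*) [Field K] (m s : ℕ) :
    minorsIdeal s (hankelQ K m) ≤ minorsIdeal s (hankelP2 K m) := by
  refine Ideal.span_le.2 ?_
  rintro d ⟨ρ, γ, hρ, hγ, rfl⟩
  exact minorsIdeal_mem (hankelP2 K m) (fun i => ⟨(ρ i : ℕ), by
      have := (ρ i).isLt
      omega⟩) γ (fun a b hab => hρ hab) hγ

lemma top_P1 {K : Type*} [Field K] (m s : ℕ) (f : MvPolynomial (Fin (2 * m - 1)) K)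
    (hf : f ∈ minorsIdeal s (hankelP1 K m)) (u : Fin (2 * m - 1) →₀ ℕ) (hu : u ∈ f.support)
    (hmax : ∀ v ∈ f.support, sqWt _ v ≤ sqWt _ u) :
    ∃ c, SparseChain {a | (∃ h : a < 2 * m - 1, u ⟨a, h⟩ ≠ 0) ∧ a < 2 * m - 2} s c := by
  refine top_chain _ s (fun a => a < 2 * m - 2) _ ?_ f hf u hu hmax
  refine Ideal.span_mono ?_
  rintro d ⟨ρ, γ, hρ, hγ, rfl⟩
  refine ⟨fun i => ρ i, fun i => γ i, ?_, ?_, rfl⟩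
  all_goals
    intro i j
    have := (ρ i).isLt
    have := (γ j).isLt
    dsimp only
    omega

lemma top_P2 {K : Type*} [Field K] (m s : ℕ) (f : MvPolynomial (Fin (2 * m - 1)) K)
    (hf : f ∈ minorsIdeal s (hankelP2 K m)) (u : Fin (2 * m - 1) →₀ ℕ) (hu : u ∈ f.support)
    (hmax : ∀ v ∈ f.support, sqWt _ v ≤ sqWt _ u) :
    ∃ c, SparseChain {a | (∃ h : a < 2 * m - 1, u ⟨a, h⟩ ≠ 0) ∧ 1 ≤ a ∧ a ≤ 2 * m - 2} s c := by
  refine top_chain _ s (fun a => 1 ≤ a ∧ a ≤ 2 * m - 2) _ ?_ f hf u hu hmax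
  refine Ideal.span_mono ?_
  rintro d ⟨ρ, γ, hρ, hγ, rfl⟩
  refine ⟨fun i => ρ i, fun i => γ i + 1, ?_, ?_, rfl⟩
  all_goals
    intro i j
    have := (ρ i).isLt
    have := (γ j).isLt
    dsimp only
    omega

lemma lead_X {K : Type*} [Field K] (m s : ℕ) (u : Fin (2 * m - 1) →₀ ℕ) (c : ℕ → ℕ)
    (hc : SparseChain {a | (∃ h : a < 2 * m - 1, u ⟨a, h⟩ ≠ 0) ∧ a ≤ 2 * m - 2} s c) :
    ∃ h ∈ minorsIdeal s (hankelX K m),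
      MvPolynomial.monomial u 1 - h ∈ lowWt K _ (sqWt _ u) := by
  obtain ⟨h1, h2⟩ := hc
  have hb : ∀ i : Fin s, c i < 2 * m - 1 := fun i => (h1 i i.2).1.1
  let ρ : Fin s → Fin m := fun i => ⟨c i / 2, by have := hb i; omega⟩
  let γ : Fin s → Fin m := fun i => ⟨c i - c i / 2, by have := hb i; omega⟩
  have hρ : StrictMono ρ := by
    intro a b hab
    have := h2 a b hab b.2
    show c a / 2 < c b / 2
    omega
  have hγ : StrictMono γ := by
    intro a b hab
    have := h2 a b hab b.2
    show c a - c a / 2 < c b - c b / 2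
    omega
  obtain ⟨q, hq⟩ := minor_lead (K := K) (2 * m - 1) s (fun i => ρ i) (fun i => γ i) hρ hγ 0
    (fun i j => by have := (ρ i).isLt; have := (γ j).isLt; omega) u (fun i => by
      obtain ⟨⟨_, h⟩, _⟩ := h1 i i.2
      convert h using 3
      simp only [ρ, γ]
      omega)
  exact ⟨_, Ideal.mul_mem_left _ q (minorsIdeal_mem (hankelX K m) ρ γ hρ hγ), hq⟩

lemma lead_Q {K : Type*} [Field K] (m s : ℕ) (u : Fin (2 * m - 1) →₀ ℕ) (c : ℕ → ℕ)
    (hc : SparseChain {a | (∃ h : a < 2 * m - 1, u ⟨a, h⟩ ≠ 0) ∧ 1 ≤ a ∧ a < 2 * m - 2} s c) :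
    ∃ h ∈ minorsIdeal s (hankelQ K m),
      MvPolynomial.monomial u 1 - h ∈ lowWt K _ (sqWt _ u) := by
  obtain ⟨h1, h2⟩ := hc
  have hb : ∀ i : Fin s, 1 ≤ c i ∧ c i < 2 * m - 2 := fun i => (h1 i i.2).2
  let ρ : Fin s → Fin (m - 1) := fun i => ⟨(c i - 1) / 2, by have := hb i; omega⟩
  let γ : Fin s → Fin (m - 1) := fun i => ⟨(c i - 1) - (c i - 1) / 2, by have := hb i; omega⟩
  have hρ : StrictMono ρ := by
    intro a b hab
    have := h2 a b hab b.2
    have := hb a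
    show (c a - 1) / 2 < (c b - 1) / 2
    omega
  have hγ : StrictMono γ := by
    intro a b hab
    have := h2 a b hab b.2
    have := hb a
    show (c a - 1) - (c a - 1) / 2 < (c b - 1) - (c b - 1) / 2
    omega
  obtain ⟨q, hq⟩ := minor_lead (K := K) (2 * m - 1) s (fun i => ρ i) (fun i => γ i) hρ hγ 1
    (fun i j => by have := (ρ i).isLt; have := (γ j).isLt; omega) u (fun i => by
      obtain ⟨⟨_, h⟩, _⟩ := h1 i i.2
      have := hb i
      convert h using 3
      simp only [ρ, γ]
      omega)
  exact ⟨_, Ideal.mul_mem_left _ q (minorsIdeal_mem (hankelQ K m) ρ γ hρ hγ), hq⟩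

/-- Abstract reduction by leading forms. -/
lemma mem_of_lead {K : Type*} [Field K] (n : ℕ) (I J : Ideal (MvPolynomial (Fin n) K))
    (hIJ : I ≤ J)
    (H : ∀ f ∈ J, ∀ u ∈ f.support, (∀ v ∈ f.support, sqWt n v ≤ sqWt n u) →
      ∃ h ∈ I, MvPolynomial.monomial u 1 - h ∈ lowWt K n (sqWt n u)) :
    ∀ W : ℕ, ∀ f ∈ J, f ∈ lowWt K n W → f ∈ I := by
  classical
  intro W
  induction W with
  | zero =>
    intro f _ hlow
    rw [MvPolynomial.mem_restrictSupport_iff] at hlow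
    have : f = 0 := by
      rw [← MvPolynomial.support_eq_empty, Finset.eq_empty_iff_forall_notMem]
      intro v hv
      exact absurd (hlow hv) (Nat.not_lt_zero _)
    rw [this]
    exact I.zero_mem
  | succ W ih =>
    intro f hf hlow
    rw [MvPolynomial.mem_restrictSupport_iff] at hlow
    have hlow' : ∀ v ∈ f.support, sqWt n v ≤ W := fun v hv => Nat.lt_succ_iff.1 (hlow hv)
    have hex : ∀ u : Fin n →₀ ℕ, ∃ h ∈ I, u ∈ f.support → sqWt n u = W →
        MvPolynomial.monomial u 1 - h ∈ lowWt K n W := by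
      intro u
      by_cases hu : u ∈ f.support ∧ sqWt n u = W
      · obtain ⟨h, hh, hh'⟩ := H f hf u hu.1 (by rw [hu.2]; exact hlow')
        rw [hu.2] at hh'
        exact ⟨h, hh, fun _ _ => hh'⟩
      · exact ⟨0, I.zero_mem, fun a b => absurd ⟨a, b⟩ hu⟩
    choose h hI hh using hex
    set T := f.support.filter (fun v => sqWt n v = W)
    have hg : ∑ u ∈ T, MvPolynomial.C (f.coeff u) * h u ∈ I :=
      Ideal.sum_mem _ fun u _ => Ideal.mul_mem_left _ _ (hI u)
    have hlowg : f - ∑ u ∈ T, MvPolynomial.C (f.coeff u) * h u ∈ lowWt K n W := by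
      have e : f - ∑ u ∈ T, MvPolynomial.C (f.coeff u) * h u =
          ∑ u ∈ f.support.filter (fun v => ¬ sqWt n v = W), MvPolynomial.monomial u (f.coeff u) +
          ∑ u ∈ T, f.coeff u • (MvPolynomial.monomial u 1 - h u) := by
        have e1 := Finset.sum_filter_add_sum_filter_not f.support (fun v => sqWt n v = W)
          (fun u => MvPolynomial.monomial u (f.coeff u))
        rw [MvPolynomial.support_sum_monomial_coeff] at e1
        simp only [smul_sub, Finset.sum_sub_distrib, MvPolynomial.smul_eq_C_mul,
          MvPolynomial.C_mul_monomial, mul_one]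
        rw [← add_sub_assoc, sub_left_inj, add_comm]
        exact e1.symm
      rw [e]
      refine Submodule.add_mem _ (Submodule.sum_mem _ fun u hu => ?_)
        (Submodule.sum_mem _ fun u hu => Submodule.smul_mem _ _ ?_)
      · rw [MvPolynomial.monomial_mem_restrictSupport]
        left
        rw [Finset.mem_filter] at hu
        exact lt_of_le_of_ne (hlow' u hu.1) hu.2
      · rw [Finset.mem_filter] at hu
        exact hh u hu.1 hu.2
    have := ih _ (J.sub_mem hf (hIJ hg)) hlowg
    have h3 := I.add_mem this hg
    rwa [sub_add_cancel] at h3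

/-- **Proposition 3.8(1).** Let `n = 2m-1`, `X` the generic square Hankel matrix of size `m`,
`P₁` (resp. `P₂`, `Q`) the Hankel matrix obtained from `X` by dropping the last row (resp. the
first column, resp. both). Then for every `2 ≤ t ≤ m` one has the primary decomposition
`I_t(X) + I_{t-1}(Q) = I_{t-1}(P₁) ∩ I_{t-1}(P₂)`. -/
theorem hankel_primary_decomposition_one {K : Type*} [Field K] (m : ℕ) (t : ℕ)
    (ht2 : 2 ≤ t) (htm : t ≤ m) :
    minorsIdeal t (hankelX K m) + minorsIdeal (t - 1) (hankelQ K m) =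
      minorsIdeal (t - 1) (hankelP1 K m) ⊓ minorsIdeal (t - 1) (hankelP2 K m) := by
  obtain ⟨s, rfl⟩ : ∃ s, t = s + 1 := ⟨t - 1, by omega⟩
  simp only [Nat.add_sub_cancel]
  rw [Submodule.add_eq_sup]
  have hle : minorsIdeal (s + 1) (hankelX K m) ⊔ minorsIdeal s (hankelQ K m) ≤
      minorsIdeal s (hankelP1 K m) ⊓ minorsIdeal s (hankelP2 K m) :=
    sup_le (le_inf (X_le_P1 K m s) (X_le_P2 K m s)) (le_inf (Q_le_P1 K m s) (Q_le_P2 K m s))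
  refine le_antisymm hle ?_
  intro f hf
  refine mem_of_lead (2 * m - 1) _ _ hle ?_ (f.support.sup (sqWt _) + 1) f hf ?_
  · intro g hg u hu hmax
    obtain ⟨c, hc⟩ := top_P1 m s g hg.1 u hu hmax
    obtain ⟨d, hd⟩ := top_P2 m s g hg.2 u hu hmax
    rcases sparse_exchange {a | ∃ h : a < 2 * m - 1, u ⟨a, h⟩ ≠ 0} (2 * m - 2) s (m - 1)
      (by omega) (by omega) c d hc hd with ⟨e, he⟩ | ⟨e, he⟩
    · obtain ⟨h, hI, hlow⟩ := lead_Q (K := K) m s u e he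
      exact ⟨h, Ideal.mem_sup_right hI, hlow⟩
    · obtain ⟨h, hI, hlow⟩ := lead_X (K := K) m (s + 1) u e he
      exact ⟨h, Ideal.mem_sup_left hI, hlow⟩
  · rw [MvPolynomial.mem_restrictSupport_iff]
    intro v hv
    exact Nat.lt_succ_iff.2 (Finset.le_sup (f := sqWt (2 * m - 1)) hv)
end

section
/- Let K be a field, n = 2m−1, S = K[x₁,…,xₙ], let X be the m×m generic Hankel matrix with entries x₁,…,xₙ, P₁ the matrix obtained by dropping the last row of X, P₂ the matrix obtained by dropping the first column of X, and Q the matrix obtained by dropping both. Then for every t with 3 ≤ t ≤ m one has the primary decomposition I_{t−1}(P₁) + I_{t−1}(P₂) = I_{t−1}(X) ∩ I_{t−2}(Q). -/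
namespace HankelAux

open MvPolynomial

/-- A set of indices in which any two distinct elements differ by at least two. -/
def Gap (P : Finset ℕ) : Prop := ∀ p ∈ P, ∀ q ∈ P, p < q → p + 2 ≤ q

/-- Greedy cover of a finite set by pairs `{p, p+1}`. -/
lemma greedy (T : Finset ℕ) : ∃ P ⊆ T, Gap P ∧ ∀ i ∈ T, ∃ p ∈ P, i = p ∨ i = p + 1 := by
  induction T using Finset.strongInduction with
  | H T ih =>
    rcases T.eq_empty_or_nonempty with rfl | hT
    · exact ⟨∅, by simp, by simp [Gap], by simp⟩
    · set a := T.min' hT with ha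
      have haT : a ∈ T := T.min'_mem hT
      have hmin : ∀ x ∈ T, a ≤ x := fun x hx => T.min'_le x hx
      obtain ⟨P, hP, hg, hc⟩ := ih (T.filter (fun x => a + 1 < x)) (by
        refine Finset.filter_ssubset.2 ⟨a, haT, by omega⟩)
      refine ⟨insert a P, ?_, ?_, ?_⟩
      · intro x hx
        rcases Finset.mem_insert.1 hx with rfl | hx
        · exact haT
        · exact (Finset.mem_filter.1 (hP hx)).1
      · intro p hp q hq hpq
        rcases Finset.mem_insert.1 hp with rfl | hp <;> rcases Finset.mem_insert.1 hq with h | hq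
        · omega
        · have := (Finset.mem_filter.1 (hP hq)).2
          omega
        · have := (Finset.mem_filter.1 (hP hp)).2
          omega
        · exact hg p hp q hq hpq
      · intro i hi
        by_cases h : a + 1 < i
        · obtain ⟨p, hp, h2⟩ := hc i (Finset.mem_filter.2 ⟨hi, h⟩)
          exact ⟨p, Finset.mem_insert_of_mem hp, h2⟩
        · have := hmin i hi
          exact ⟨a, Finset.mem_insert_self _ _, by omega⟩

/-- The weight `∑ αᵢ (i² + C)`. -/
noncomputable def wt {n : ℕ} (C : ℕ) : (Fin n →₀ ℕ) →+ ℕ :=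
  Finsupp.weight (fun i : Fin n => (i : ℕ) ^ 2 + C)

lemma det_zero {R : Type*} [CommRing R] [IsDomain R] {s : ℕ} (P : Finset ℕ) (hP : P.card < s)
    (A : Fin s → ℕ → R) (B : ℕ → Fin s → R) :
    (Matrix.of fun i j => ∑ p ∈ P, A i p * B p j : Matrix (Fin s) (Fin s) R).det = 0 := by
  by_contra hne
  set M : Matrix (Fin s) (Fin s) R := Matrix.of fun i j => ∑ p ∈ P, A i p * B p j with hM
  set e := algebraMap R (FractionRing R)
  have h1 : (M.map e).det ≠ 0 := by
    rw [← RingHom.mapMatrix_apply, ← RingHom.map_det]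
    intro h
    exact hne ((IsFractionRing.injective R (FractionRing R)) (h.trans (map_zero e).symm))
  have h2 : (M.map e).rank = s := by
    rw [Matrix.rank_of_isUnit _ ((Matrix.isUnit_iff_isUnit_det _).2 (isUnit_iff_ne_zero.2 h1))]
    simp
  have h3 : M.map e = (Matrix.of fun i (p : P) => e (A i p) : Matrix (Fin s) P (FractionRing R)) *
      (Matrix.of fun (p : P) j => e (B p j)) := by
    ext i j
    simp only [hM, Matrix.map_apply, Matrix.of_apply, Matrix.mul_apply, map_sum, map_mul]
    exact (Finset.sum_coe_sort P (fun p => e (A i p) * e (B p j))).symm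
  have h4 := Matrix.rank_mul_le_left
    (Matrix.of fun i (p : P) => e (A i p) : Matrix (Fin s) P (FractionRing R))
      (Matrix.of fun (p : P) j => e (B p j))
  have h5 := Matrix.rank_le_card_width
    (Matrix.of fun i (p : P) => e (A i p) : Matrix (Fin s) P (FractionRing R))
  rw [← h3, h2] at h4
  simp at h5
  omega

lemma prod_top {F ι : Type*} [CommRing F] (T : Finset ι) (y : ι → Polynomial F) (ω : ι → ℕ)
    (a : ι → ℕ) (hy : ∀ i, (y i).natDegree ≤ ω i) :
    (∏ i ∈ T, y i ^ a i).natDegree ≤ ∑ i ∈ T, a i * ω i ∧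
    (∏ i ∈ T, y i ^ a i).coeff (∑ i ∈ T, a i * ω i) = ∏ i ∈ T, (y i).coeff (ω i) ^ a i := by
  classical
  induction T using Finset.induction_on with
  | empty => simp
  | insert i T hi ih =>
    have h0 : (y i ^ a i).natDegree ≤ a i * ω i :=
      Polynomial.natDegree_pow_le.trans (Nat.mul_le_mul_left _ (hy i))
    rw [Finset.prod_insert hi, Finset.sum_insert hi, Finset.prod_insert hi]
    refine ⟨Polynomial.natDegree_mul_le.trans (add_le_add h0 ih.1), ?_⟩
    rw [Polynomial.coeff_mul_add_eq_of_natDegree_le h0 ih.1, ih.2,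
      Polynomial.coeff_pow_of_natDegree_le (hy i)]

/-- The top coefficient of the image under a substitution is nonzero. -/
lemma subst_ne_zero {K F : Type*} [Field K] [Field F] [Algebra K F] {n : ℕ} (C : ℕ)
    (G : MvPolynomial (Fin n) K →ₐ[K] F) (hG : Function.Injective G)
    (y : Fin n → Polynomial F) (cnt : Fin n → ℕ)
    (hy : ∀ i, (y i).natDegree ≤ (i : ℕ) ^ 2 + C)
    (hy2 : ∀ i, (y i).coeff ((i : ℕ) ^ 2 + C) = cnt i * G (X i))
    (f : MvPolynomial (Fin n) K) (N : ℕ) (hN : ∀ α ∈ f.support, wt C α ≤ N)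
    (w : Fin n →₀ ℕ) (hw : w ∈ f.support) (hwN : wt C w = N) (hcnt : ∀ i ∈ w.support, cnt i = 1) :
    aeval y f ≠ 0 := by
  classical
  have hcoef : ∀ α ∈ f.support, (algebraMap K (Polynomial F) (coeff α f) *
      ∏ i ∈ α.support, y i ^ α i).coeff N = G (if wt C α = N then
        monomial α (coeff α f * ∏ i ∈ α.support, (cnt i : K) ^ α i) else 0) := by
    intro α hα
    have hs : wt C α = ∑ i ∈ α.support, α i * ((i : ℕ) ^ 2 + C) := by
      simp [wt, Finsupp.weight_apply, Finsupp.sum]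
    have ht := prod_top α.support y (fun i => (i : ℕ) ^ 2 + C) α hy
    rw [← hs] at ht
    rw [Polynomial.algebraMap_apply, Polynomial.coeff_C_mul]
    split_ifs with h
    · rw [← h, ht.2]
      have : (monomial α (coeff α f * ∏ i ∈ α.support, (cnt i : K) ^ α i) :
          MvPolynomial (Fin n) K) = MvPolynomial.C (coeff α f) *
            ∏ i ∈ α.support, ((cnt i : MvPolynomial (Fin n) K) * X i) ^ α i := by
        simp_rw [mul_pow]
        rw [Finset.prod_mul_distrib, prod_X_pow_eq_monomial, ← mul_assoc]
        have : (∏ i ∈ α.support, (cnt i : MvPolynomial (Fin n) K) ^ α i)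
            = MvPolynomial.C (∏ i ∈ α.support, (cnt i : K) ^ α i) := by simp
        rw [this, ← map_mul, C_mul_monomial, mul_one]
      rw [this, map_mul, map_prod]
      congr 1
      · rw [← MvPolynomial.algebraMap_eq, AlgHom.commutes]
      · refine Finset.prod_congr rfl fun i _ => ?_
        rw [hy2, map_pow, map_mul, map_natCast]
    · rw [map_zero, Polynomial.coeff_eq_zero_of_natDegree_lt, mul_zero]
      exact ht.1.trans_lt (lt_of_le_of_ne (hN α hα) h)
  intro h0
  have h1 := congrArg (fun q => Polynomial.coeff q N) h0
  simp only [aeval_def, eval₂_eq, Polynomial.finsetSum_coeff, Polynomial.coeff_zero] at h1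
  rw [Finset.sum_congr rfl hcoef, ← map_sum, map_eq_zero_iff G hG] at h1
  have h2 := congrArg (coeff w) h1
  rw [coeff_sum, Finset.sum_eq_single w, if_pos hwN, coeff_monomial, if_pos rfl, coeff_zero,
    Finset.prod_eq_one, mul_one] at h2
  · exact (mem_support_iff.1 hw) h2
  · intro i hi
    simp [hcnt i hi]
  · intro b _ hb
    split_ifs
    · rw [coeff_monomial, if_neg hb]
    · simp
  · intro h
    exact absurd hw h

lemma expo {C p i : ℕ} (hC : p * (p + 1) ≤ C) :
    (C - p * (p + 1)) + (2 * p + 1) * i ≤ i ^ 2 + C ∧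
    ((C - p * (p + 1)) + (2 * p + 1) * i = i ^ 2 + C ↔ (i = p ∨ i = p + 1)) := by
  obtain ⟨D, rfl⟩ := Nat.exists_eq_add_of_le hC
  have : p * (p + 1) + D - p * (p + 1) = D := by omega
  rw [this]
  rcases le_or_gt i p with h | h
  · obtain ⟨e, rfl⟩ := Nat.exists_eq_add_of_le h
    constructor
    · nlinarith
    · constructor
      · intro h
        left
        have : e * (e + 1) = 0 := by nlinarith
        rcases Nat.mul_eq_zero.1 this with h | h <;> omega
      · rintro (h | h)
        · have : e = 0 := by omega
          subst this
          ring
        · omega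
  · obtain ⟨e, rfl⟩ := Nat.exists_eq_add_of_le (Nat.succ_le_of_lt h)
    simp only [Nat.succ_eq_add_one]
    constructor
    · nlinarith
    · constructor
      · intro h
        right
        have : e * (e + 1) = 0 := by nlinarith
        rcases Nat.mul_eq_zero.1 this with h | h <;> omega
      · rintro (h | h)
        · omega
        · have : e = 0 := by omega
          subst this
          ring

/-- If `f` lies in an ideal of minors of a Hankel matrix, then every monomial of `f` of top weight
is divisible by a gap chain. -/
lemma key {K : Type*} [Field K] {n : ℕ} (I : ℕ → Prop) {s r c : ℕ} (off C : ℕ)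
    (M : Matrix (Fin r) (Fin c) (MvPolynomial (Fin n) K))
    (hM : ∀ i j, ∃ k : Fin n, k.1 = i.1 + j.1 + off ∧ I k.1 ∧ M i j = X k)
    (hC : ∀ p < n, p * (p + 1) ≤ C)
    (f : MvPolynomial (Fin n) K) (hf : f ∈ minorsIdeal s M) (N : ℕ)
    (hN : ∀ α ∈ f.support, wt C α ≤ N)
    (w : Fin n →₀ ℕ) (hw : w ∈ f.support) (hwN : wt C w = N) :
    ∃ P : Finset ℕ, P.card = s ∧ Gap P ∧ ∀ p ∈ P, I p ∧ ∃ k : Fin n, k.1 = p ∧ w k ≠ 0 := by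
  classical
  by_contra hno
  set T : Finset ℕ := (w.support.image (fun k : Fin n => k.1)).filter I with hT
  obtain ⟨P, hPT, hgap, hcov⟩ := greedy T
  have hP : ∀ p ∈ P, I p ∧ ∃ k : Fin n, k.1 = p ∧ w k ≠ 0 := by
    intro p hp
    have := hPT hp
    simp only [hT, Finset.mem_filter, Finset.mem_image, Finsupp.mem_support_iff] at this
    obtain ⟨⟨k, hk, rfl⟩, h⟩ := this
    exact ⟨h, k, rfl, hk⟩
  have hPC : ∀ p ∈ P, p * (p + 1) ≤ C := by
    intro p hp
    obtain ⟨_, k, rfl, _⟩ := hP p hp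
    exact hC _ k.2
  have hcard : P.card < s := by
    by_contra h
    obtain ⟨P', hP', hc'⟩ := Finset.exists_subset_card_eq (not_lt.1 h)
    exact hno ⟨P', hc', fun p hp q hq => hgap p (hP' hp) q (hP' hq), fun p hp => hP p (hP' hp)⟩
  let F := FractionRing (MvPolynomial ℕ K)
  let ξ : ℕ → F := fun i => algebraMap (MvPolynomial ℕ K) F (X i)
  have hinj : Function.Injective (algebraMap (MvPolynomial ℕ K) F) := IsFractionRing.injective _ _
  have hξ : ∀ i, ξ i ≠ 0 := fun i h => X_ne_zero (R := K) i
    (hinj (h.trans (map_zero (algebraMap (MvPolynomial ℕ K) F)).symm))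
  let G : MvPolynomial (Fin n) K →ₐ[K] F :=
    (IsScalarTower.toAlgHom K (MvPolynomial ℕ K) F).comp (rename (fun k : Fin n => k.1))
  have hG : Function.Injective G :=
    hinj.comp (rename_injective _ Fin.val_injective)
  have hGX : ∀ i : Fin n, G (X i) = ξ i.1 := by
    intro i
    simp [G, ξ]
  let v : ℕ → F := fun p => ξ (p + 1) / ξ p
  have hv : ∀ p, v p ≠ 0 := fun p => div_ne_zero (hξ _) (hξ _)
  let a : ℕ → Polynomial F := fun p =>
    Polynomial.C (ξ p / v p ^ p) * Polynomial.X ^ (C - p * (p + 1))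
  let b : ℕ → Polynomial F := fun p => Polynomial.C (v p) * Polynomial.X ^ (2 * p + 1)
  have hab : ∀ p i, a p * b p ^ i = Polynomial.C (ξ p / v p ^ p * v p ^ i) *
      Polynomial.X ^ ((C - p * (p + 1)) + (2 * p + 1) * i) := by
    intro p i
    simp only [a, b, mul_pow, ← pow_mul, pow_add, map_mul, map_pow]
    ring
  let y : Fin n → Polynomial F := fun i => if I i.1 then ∑ p ∈ P, a p * b p ^ i.1 else
    Polynomial.C (ξ i.1) * Polynomial.X ^ (i.1 ^ 2 + C)
  let cnt : Fin n → ℕ := fun i => if I i.1 then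
    (P.filter (fun p => i.1 = p ∨ i.1 = p + 1)).card else 1
  refine subst_ne_zero C G hG y cnt ?_ ?_ f N hN w hw hwN ?_ ?_
  · intro i
    simp only [y]
    split_ifs with hi
    · refine Polynomial.natDegree_sum_le_of_forall_le _ _ fun p hp => ?_
      rw [hab]
      exact (Polynomial.natDegree_C_mul_X_pow_le _ _).trans (expo (hPC p hp)).1
    · exact Polynomial.natDegree_C_mul_X_pow_le _ _
  · intro i
    simp only [y, cnt]
    split_ifs with hi
    · rw [Polynomial.finsetSum_coeff, hGX, Finset.card_filter, Nat.cast_sum, Finset.sum_mul]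
      refine Finset.sum_congr rfl fun p hp => ?_
      rw [hab, Polynomial.coeff_C_mul_X_pow]
      have h1 := (expo (i := i.1) (hPC p hp)).2
      by_cases h : i.1 = p ∨ i.1 = p + 1
      · rw [if_pos (h1.2 h).symm, if_pos h]
        rcases h with h | h
        · rw [h, div_mul_cancel₀ _ (pow_ne_zero _ (hv p))]
          simp
        · rw [h, pow_succ, ← mul_assoc, div_mul_cancel₀ _ (pow_ne_zero _ (hv p))]
          simp only [v]
          rw [mul_div_cancel₀ _ (hξ p)]
          simp
      · rw [if_neg (fun e => h (h1.1 e.symm)), if_neg h]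
        simp
    · rw [hGX]
      simp
  · intro i hi
    simp only [cnt]
    split_ifs with hI
    · obtain ⟨p, hp, hip⟩ := hcov i.1 (by
        simp only [hT, Finset.mem_filter, Finset.mem_image]
        exact ⟨⟨i, hi, rfl⟩, hI⟩)
      rw [Finset.card_eq_one]
      refine ⟨p, ?_⟩
      ext q
      simp only [Finset.mem_filter, Finset.mem_singleton]
      constructor
      · rintro ⟨hq, hiq⟩
        have h1 := hgap p hp q hq
        have h2 := hgap q hq p hp
        omega
      · rintro rfl
        exact ⟨hp, hip⟩
    · rfl
  · have hker : minorsIdeal s M ≤ RingHom.ker (aeval y : MvPolynomial (Fin n) K →ₐ[K] _) := by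
      refine Ideal.span_le.2 ?_
      rintro d ⟨ρ, γ, _, _, rfl⟩
      rw [SetLike.mem_coe, RingHom.mem_ker, AlgHom.map_det]
      rw [← det_zero P hcard (fun i p => a p * b p ^ (ρ i).1)
        (fun p j => b p ^ ((γ j).1 + off))]
      congr 1
      ext1 i j
      obtain ⟨k, hk, hIk, hMk⟩ := hM (ρ i) (γ j)
      simp only [AlgHom.mapMatrix_apply, Matrix.map_apply, Matrix.submatrix_apply, Matrix.of_apply,
        hMk, aeval_X]
      simp only [y, if_pos hIk]
      refine Finset.sum_congr rfl fun p _ => ?_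
      rw [hk]
      ring
    exact hker hf

/-- A sequence whose first `s` terms have gaps at least two. -/
def Seq (s : ℕ) (c : ℕ → ℕ) : Prop := ∀ i, i + 1 < s → c i + 2 ≤ c (i + 1)

lemma Seq.lt {s : ℕ} {c : ℕ → ℕ} (h : Seq s c) {i j : ℕ} (hij : i < j) (hj : j < s) :
    c i + 2 ≤ c j := by
  induction j with
  | zero => omega
  | succ j ih =>
    have h1 := h j hj
    rcases Nat.lt_succ_iff_lt_or_eq.1 hij with h2 | h2
    · have := ih h2 (by omega)
      omega
    · rw [h2]
      exact h1

lemma gap_seq {P : Finset ℕ} {s : ℕ} (hc : P.card = s) (hg : Gap P) :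
    ∃ a : ℕ → ℕ, Seq s a ∧ ∀ i < s, a i ∈ P := by
  refine ⟨fun i => if h : i < s then P.orderEmbOfFin hc ⟨i, h⟩ else 0, ?_, ?_⟩
  · intro i hi
    have hi' : i < s := by omega
    simp only [hi, hi', dif_pos]
    refine hg _ (Finset.orderEmbOfFin_mem _ _ _) _ (Finset.orderEmbOfFin_mem _ _ _) ?_
    exact (P.orderEmbOfFin hc).strictMono (by simp [Fin.lt_def])
  · intro i hi
    simp only [hi, dif_pos]
    exact Finset.orderEmbOfFin_mem _ _ _

lemma comb {m k : ℕ} (hk : k + 2 ≤ m) (T : ℕ → Prop) (a b : ℕ → ℕ) (ha : Seq (k + 1) a)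
    (hb : Seq k b) (haT : ∀ i < k + 1, T (a i) ∧ a i ≤ 2 * m - 2)
    (hbT : ∀ i < k, T (b i) ∧ 1 ≤ b i ∧ b i ≤ 2 * m - 3) :
    ∃ c : ℕ → ℕ, Seq (k + 1) c ∧ (∀ i < k + 1, T (c i) ∧ c i ≤ 2 * m - 2) ∧
      ((∀ i < k + 1, c i ≤ 2 * m - 3) ∨ (∀ i < k + 1, 1 ≤ c i)) := by
  by_cases h1 : ∃ i < k, a i + 2 ≤ b i
  · obtain ⟨i, hi, hab⟩ := h1
    refine ⟨fun j => if j ≤ i then a j else b (j - 1), ?_, ?_, Or.inl ?_⟩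
    · intro j hj
      rcases lt_trichotomy j i with h | h | h
      · simp only [if_pos h.le, if_pos (show j + 1 ≤ i by omega)]
        exact ha j hj
      · subst h
        simpa using hab
      · simp only [if_neg (show ¬ j ≤ i by omega), if_neg (show ¬ j + 1 ≤ i by omega)]
        have := hb (j - 1) (by omega)
        rwa [show j - 1 + 1 = j + 1 - 1 by omega] at this
    · intro j hj
      dsimp only
      split_ifs with h
      · exact haT j hj
      · have := hbT (j - 1) (by omega)
        exact ⟨this.1, by omega⟩
    · intro j hj
      dsimp only
      split_ifs with h
      · have := ha.lt (show j < k by omega) (by omega)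
        have := (haT k (by omega)).2
        omega
      · exact (hbT (j - 1) (by omega)).2.2
  by_cases h2 : ∃ i < k, b i + 2 ≤ a (i + 1)
  · obtain ⟨i, hi, hab⟩ := h2
    refine ⟨fun j => if j ≤ i then b j else a j, ?_, ?_, Or.inr ?_⟩
    · intro j hj
      rcases lt_trichotomy j i with h | h | h
      · simp only [if_pos h.le, if_pos (show j + 1 ≤ i by omega)]
        exact hb j (by omega)
      · subst h
        simpa using hab
      · simp only [if_neg (show ¬ j ≤ i by omega), if_neg (show ¬ j + 1 ≤ i by omega)]
        exact ha j hj
    · intro j hj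
      dsimp only
      split_ifs with h
      · have := hbT j (by omega)
        exact ⟨this.1, by omega⟩
      · exact haT j hj
    · intro j hj
      dsimp only
      split_ifs with h
      · exact (hbT j (by omega)).2.1
      · have := ha.lt (show 0 < j by omega) hj
        omega
  push Not at h1 h2
  refine ⟨a, ha, haT, ?_⟩
  by_cases h0 : a 0 = 0
  · left
    have : ∀ j < k + 1, a j ≤ 2 * j := by
      intro j
      induction j with
      | zero => intro _; omega
      | succ j ih =>
        intro hj
        have := ih (by omega)
        have := h1 j (by omega)
        have := h2 j (by omega)
        omega
    intro j hj
    have := this j hj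
    omega
  · right
    intro j hj
    rcases Nat.eq_zero_or_pos j with rfl | h
    · omega
    · have := ha.lt h hj
      omega

lemma rearr {s : ℕ} (ρ γ : Fin s → ℕ) (hρ : StrictMono ρ) (hγ : StrictMono γ)
    (σ : Equiv.Perm (Fin s)) (hσ : σ ≠ 1) : ∑ i, ρ (σ i) * γ i < ∑ i, ρ i * γ i := by
  have hm : Monovary ρ γ := hρ.monotone.monovary hγ.monotone
  rw [hm.sum_comp_perm_mul_lt_sum_mul_iff]
  intro h
  apply hσ
  have hs : StrictMono σ := by
    refine Monotone.strictMono_of_injective ?_ σ.injective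
    intro i j hij
    rcases hij.lt_or_eq with h1 | h1
    · exact hρ.le_iff_le.1 (h (hγ h1))
    · rw [h1]
  have := (hs.range_inj strictMono_id).1 (by simp [σ.surjective.range_eq])
  ext i
  simp [this]

lemma minor_lead {K : Type*} [Field K] {n s r c : ℕ} (off C : ℕ)
    (M : Matrix (Fin r) (Fin c) (MvPolynomial (Fin n) K))
    (hM : ∀ i j, ∃ k : Fin n, k.1 = i.1 + j.1 + off ∧ M i j = X k)
    (ρ : Fin s → Fin r) (γ : Fin s → Fin c) (hρ : StrictMono ρ) (hγ : StrictMono γ)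
    (α : Fin n →₀ ℕ)
    (hα : ∀ i, ∃ k : Fin n, k.1 = (ρ i).1 + (γ i).1 + off ∧ α k ≠ 0) (x : K) :
    monomial α x ∈ (minorsIdeal s M).restrictScalars K ⊔
      restrictSupport K {β : Fin n →₀ ℕ | wt C β < wt C α} := by
  classical
  choose κ hκ hMκ using hM
  let e : Equiv.Perm (Fin s) → Fin n →₀ ℕ := fun σ => ∑ i, Finsupp.single (κ (ρ (σ i)) (γ i)) 1
  have hprod : ∀ σ : Equiv.Perm (Fin s), ∏ i, M (ρ (σ i)) (γ i) = monomial (e σ) 1 := by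
    intro σ
    simp only [e]
    rw [monomial_sum_one]
    refine Finset.prod_congr rfl fun i _ => ?_
    rw [hMκ]
    rfl
  have hwt : ∀ σ, wt C (e σ) = ∑ i, (((ρ (σ i)).1 + (γ i).1 + off) ^ 2 + C) := by
    intro σ
    simp only [e, map_sum]
    refine Finset.sum_congr rfl fun i _ => ?_
    simp [wt, Finsupp.weight_single, hκ]
  have hlt : ∀ σ, σ ≠ 1 → wt C (e σ) < wt C (e 1) := by
    intro σ hσ
    rw [hwt, hwt]
    have h := rearr (fun i => (ρ i).1) (fun i => (γ i).1) hρ hγ σ hσ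
    have expand : ∀ τ : Equiv.Perm (Fin s),
        ∑ i, (((ρ (τ i)).1 + (γ i).1 + off) ^ 2 + C) =
        ∑ i, ((ρ (τ i)).1 ^ 2 + 2 * off * (ρ (τ i)).1) +
          ∑ i, ((γ i).1 ^ 2 + 2 * off * (γ i).1 + off ^ 2 + C) +
          2 * ∑ i, (ρ (τ i)).1 * (γ i).1 := by
      intro τ
      rw [Finset.mul_sum, ← Finset.sum_add_distrib, ← Finset.sum_add_distrib]
      refine Finset.sum_congr rfl fun i _ => ?_
      ring
    rw [expand, expand, Equiv.sum_comp σ (fun i => (ρ i).1 ^ 2 + 2 * off * (ρ i).1),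
      Equiv.sum_comp 1 (fun i => (ρ i).1 ^ 2 + 2 * off * (ρ i).1)]
    simp only [Equiv.Perm.coe_one, id_eq]
    omega
  have hle : e 1 ≤ α := by
    intro k
    have hk : e 1 k = (Finset.univ.filter (fun i => κ (ρ i) (γ i) = k)).card := by
      simp [e, Finsupp.finsetSum_apply, Finsupp.single_apply]
    rw [hk]
    have : (Finset.univ.filter (fun i => κ (ρ i) (γ i) = k)).card ≤ 1 := by
      rw [Finset.card_le_one]
      intro i hi j hj
      have h := (Finset.mem_filter.1 hi).2.trans (Finset.mem_filter.1 hj).2.symm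
      have h := congrArg Fin.val h
      rw [hκ, hκ] at h
      rcases lt_trichotomy i j with h1 | h1 | h1
      · have := Fin.lt_def.1 (hρ h1)
        have := Fin.lt_def.1 (hγ h1)
        omega
      · exact h1
      · have := Fin.lt_def.1 (hρ h1)
        have := Fin.lt_def.1 (hγ h1)
        omega
    rcases Finset.eq_empty_or_nonempty (Finset.univ.filter (fun i => κ (ρ i) (γ i) = k)) with h | h
    · simp [h]
    · obtain ⟨i, hi⟩ := h
      have hi := (Finset.mem_filter.1 hi).2
      obtain ⟨k', hk', h0⟩ := hα i
      have : k' = k := by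
        apply Fin.ext
        rw [hk', ← hi, hκ]
      subst this
      omega
  obtain ⟨β, hβ⟩ := exists_add_of_le hle
  have hdet : (M.submatrix ρ γ).det = monomial (e 1) 1 + ∑ σ ∈ Finset.univ.erase 1,
      (((Equiv.Perm.sign σ : ℤ) : MvPolynomial (Fin n) K)) * monomial (e σ) 1 := by
    rw [Matrix.det_apply', ← Finset.add_sum_erase _ _ (Finset.mem_univ 1)]
    simp only [Matrix.submatrix_apply, hprod]
    simp
  have hmon : monomial α x = monomial β x * (M.submatrix ρ γ).det - ∑ σ ∈ Finset.univ.erase 1,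
      monomial β x * ((((Equiv.Perm.sign σ : ℤ) : MvPolynomial (Fin n) K)) * monomial (e σ) 1) := by
    rw [hdet, mul_add, ← Finset.mul_sum, add_sub_cancel_right, monomial_mul, mul_one, hβ, add_comm]
  rw [hmon]
  refine Submodule.sub_mem _ (Submodule.mem_sup_left ?_) (Submodule.mem_sup_right ?_)
  · rw [Submodule.restrictScalars_mem]
    exact Ideal.mul_mem_left _ _ (Ideal.subset_span ⟨ρ, γ, hρ, hγ, rfl⟩)
  · refine Submodule.sum_mem _ fun σ hσ => ?_
    have h1 : monomial β x * ((((Equiv.Perm.sign σ : ℤ) : MvPolynomial (Fin n) K)) *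
        monomial (e σ) 1) = monomial (e σ + β) (((Equiv.Perm.sign σ : ℤ) : K) * x) := by
      have : (((Equiv.Perm.sign σ : ℤ) : MvPolynomial (Fin n) K)) =
        MvPolynomial.C (((Equiv.Perm.sign σ : ℤ) : K)) := by simp
      rw [this, C_mul_monomial, monomial_mul, add_comm, mul_one, mul_comm]
    rw [h1, mem_restrictSupport_iff]
    intro δ hδ
    have := support_monomial_subset hδ
    rw [Finset.mem_singleton] at this
    subst this
    simp only [Set.mem_ofPred_eq, hβ, map_add]
    have := hlt σ (Finset.ne_of_mem_erase hσ)
    omega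

lemma P1_le_X {K : Type*} [Field K] (m s : ℕ) :
    minorsIdeal s (hankelP1 K m) ≤ minorsIdeal s (hankelX K m) := by
  refine Ideal.span_le.2 ?_
  rintro d ⟨ρ, γ, hρ, hγ, rfl⟩
  refine Ideal.subset_span ⟨fun i => ⟨(ρ i).1, by omega⟩, γ, fun i j h => hρ h, hγ, ?_⟩
  rfl

lemma P2_le_X {K : Type*} [Field K] (m s : ℕ) :
    minorsIdeal s (hankelP2 K m) ≤ minorsIdeal s (hankelX K m) := by
  refine Ideal.span_le.2 ?_
  rintro d ⟨ρ, γ, hρ, hγ, rfl⟩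
  refine Ideal.subset_span ⟨ρ, fun i => ⟨(γ i).1 + 1, by omega⟩, hρ, ?_, ?_⟩
  · intro i j h
    have := Fin.lt_def.1 (hγ h)
    simp only [Fin.lt_def]
    omega
  · rfl

lemma P1_le_Q {K : Type*} [Field K] (m k : ℕ) :
    minorsIdeal (k + 1) (hankelP1 K m) ≤ minorsIdeal k (hankelQ K m) := by
  refine Ideal.span_le.2 ?_
  rintro d ⟨ρ, γ, hρ, hγ, rfl⟩
  rw [SetLike.mem_coe, Matrix.det_succ_column_zero]
  refine Ideal.sum_mem _ fun i _ => Ideal.mul_mem_left _ _ (Ideal.subset_span ?_)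
  have hpos : ∀ j : Fin k, 0 < (γ j.succ).1 := fun j =>
    lt_of_le_of_lt (Nat.zero_le _) (Fin.lt_def.1 (hγ (Fin.succ_pos j)))
  refine ⟨ρ ∘ i.succAbove, fun j => ⟨(γ j.succ).1 - 1, by have := hpos j; omega⟩,
    hρ.comp (Fin.strictMono_succAbove i), ?_, ?_⟩
  · intro a b h
    have := Fin.lt_def.1 (hγ (Fin.succ_lt_succ_iff.2 h))
    have := hpos a
    simp only [Fin.lt_def]
    omega
  · congr 1
    ext1 a b
    simp only [Matrix.submatrix_apply, hankelP1, hankelQ, Function.comp]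
    congr 2
    have := hpos b
    omega

lemma P2_le_Q {K : Type*} [Field K] (m k : ℕ) :
    minorsIdeal (k + 1) (hankelP2 K m) ≤ minorsIdeal k (hankelQ K m) := by
  refine Ideal.span_le.2 ?_
  rintro d ⟨ρ, γ, hρ, hγ, rfl⟩
  rw [SetLike.mem_coe, Matrix.det_succ_row _ (Fin.last k)]
  refine Ideal.sum_mem _ fun i _ => Ideal.mul_mem_left _ _ (Ideal.subset_span ?_)
  have hpos : ∀ j : Fin k, (ρ j.castSucc).1 < m - 1 := fun j => by
    have := Fin.lt_def.1 (hρ (Fin.castSucc_lt_last j))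
    omega
  refine ⟨fun j => ⟨(ρ j.castSucc).1, hpos j⟩, γ ∘ i.succAbove, ?_,
    hγ.comp (Fin.strictMono_succAbove i), ?_⟩
  · intro a b h
    exact Fin.lt_def.1 (hρ (Fin.castSucc_lt_castSucc_iff.2 h))
  · congr 1
    ext1 a b
    simp only [Matrix.submatrix_apply, hankelP2, hankelQ, Function.comp, Fin.succAbove_last]

lemma main_le {K : Type*} [Field K] (m k : ℕ) (hk : k + 2 ≤ m) (N : ℕ) :
    ∀ f ∈ minorsIdeal (k + 1) (hankelX K m) ⊓ minorsIdeal k (hankelQ K m),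
      (∀ α ∈ f.support, wt ((2 * m) ^ 2) α < N) →
      f ∈ minorsIdeal (k + 1) (hankelP1 K m) ⊔ minorsIdeal (k + 1) (hankelP2 K m) := by
  induction N with
  | zero =>
    intro f _ h
    have : f = 0 := by
      rw [← support_eq_empty, Finset.eq_empty_iff_forall_notMem]
      intro α hα
      exact absurd (h α hα) (by omega)
    rw [this]
    exact Ideal.zero_mem _
  | succ N ih =>
    intro f hf hN
    set J := minorsIdeal (k + 1) (hankelP1 K m) ⊔ minorsIdeal (k + 1) (hankelP2 K m) with hJ
    have hN' : ∀ α ∈ f.support, wt ((2 * m) ^ 2) α ≤ N := fun α hα => Nat.lt_succ_iff.1 (hN α hα)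
    have hC : ∀ p < 2 * m - 1, p * (p + 1) ≤ (2 * m) ^ 2 := by
      intro p hp
      rw [sq]
      exact Nat.mul_le_mul (by omega) (by omega)
    have hsum : f ∈ J.restrictScalars K ⊔
        restrictSupport K {β : Fin (2 * m - 1) →₀ ℕ | wt ((2 * m) ^ 2) β < N} := by
      rw [as_sum f]
      refine Submodule.sum_mem _ fun α hα => ?_
      rcases (hN' α hα).lt_or_eq with h | h
      · refine Submodule.mem_sup_right ?_
        rw [mem_restrictSupport_iff]
        intro δ hδ
        have := support_monomial_subset hδ
        rw [Finset.mem_singleton] at this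
        subst this
        exact h
      · obtain ⟨A, hAc, hAg, hA⟩ := key (fun i => i ≤ 2 * m - 2) 0 ((2 * m) ^ 2) (hankelX K m)
          (fun i j => ⟨⟨i.1 + j.1, by omega⟩, rfl, by dsimp only; omega, rfl⟩) hC f
          (Submodule.mem_inf.1 hf).1 N hN' α hα h
        obtain ⟨B, hBc, hBg, hB⟩ := key (fun i => 1 ≤ i ∧ i ≤ 2 * m - 3) 1 ((2 * m) ^ 2)
          (hankelQ K m)
          (fun i j => ⟨⟨i.1 + j.1 + 1, by omega⟩, rfl, by dsimp only; omega, rfl⟩) hC f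
          (Submodule.mem_inf.1 hf).2 N hN' α hα h
        obtain ⟨a, ha, haA⟩ := gap_seq hAc hAg
        obtain ⟨b, hb, hbB⟩ := gap_seq hBc hBg
        obtain ⟨c, hc, hcT, hor⟩ := comb hk (fun p => ∃ k : Fin (2 * m - 1), k.1 = p ∧ α k ≠ 0)
          a b ha hb (fun i hi => ⟨(hA _ (haA i hi)).2, (hA _ (haA i hi)).1⟩)
          (fun i hi => ⟨(hB _ (hbB i hi)).2, (hB _ (hbB i hi)).1⟩)
        rw [← h]
        rcases hor with hor | hor
        · have h1 : (minorsIdeal (k + 1) (hankelP1 K m)).restrictScalars K ≤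
              J.restrictScalars K := fun x hx => (le_sup_left : _ ≤ J) hx
          refine sup_le_sup_right h1 _ (minor_lead 0 ((2 * m) ^ 2) (hankelP1 K m)
            (fun i j => ⟨⟨i.1 + j.1, by omega⟩, rfl, rfl⟩)
            (fun i => ⟨c i / 2, by have := hor i i.2; omega⟩)
            (fun i => ⟨(c i + 1) / 2, by have := hor i i.2; omega⟩) ?_ ?_ α ?_ _)
          · intro i j hij
            have := hc.lt (Fin.lt_def.1 hij) j.2
            simp only [Fin.lt_def]
            omega
          · intro i j hij
            have := hc.lt (Fin.lt_def.1 hij) j.2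
            simp only [Fin.lt_def]
            omega
          · intro i
            obtain ⟨x, hx, hx0⟩ := (hcT i i.2).1
            exact ⟨x, by dsimp only; omega, hx0⟩
        · have h1 : (minorsIdeal (k + 1) (hankelP2 K m)).restrictScalars K ≤
              J.restrictScalars K := fun x hx => (le_sup_right : _ ≤ J) hx
          refine sup_le_sup_right h1 _ (minor_lead 1 ((2 * m) ^ 2) (hankelP2 K m)
            (fun i j => ⟨⟨i.1 + j.1 + 1, by omega⟩, rfl, rfl⟩)
            (fun i => ⟨c i / 2, by have := (hcT i i.2).2; omega⟩)
            (fun i => ⟨(c i - 1) / 2, by have := (hcT i i.2).2; omega⟩) ?_ ?_ α ?_ _)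
          · intro i j hij
            have := hc.lt (Fin.lt_def.1 hij) j.2
            simp only [Fin.lt_def]
            omega
          · intro i j hij
            have := hc.lt (Fin.lt_def.1 hij) j.2
            have := hor i i.2
            simp only [Fin.lt_def]
            omega
          · intro i
            obtain ⟨x, hx, hx0⟩ := (hcT i i.2).1
            have := hor i i.2
            exact ⟨x, by dsimp only; omega, hx0⟩
    obtain ⟨g, hg, l, hl, rfl⟩ := Submodule.mem_sup.1 hsum
    rw [Submodule.restrictScalars_mem] at hg
    have hJle : J ≤ minorsIdeal (k + 1) (hankelX K m) ⊓ minorsIdeal k (hankelQ K m) :=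
      sup_le (le_inf (P1_le_X m _) (P1_le_Q m k)) (le_inf (P2_le_X m _) (P2_le_Q m k))
    refine Ideal.add_mem _ hg (ih l ?_ ?_)
    · have := Ideal.sub_mem _ hf (hJle hg)
      rwa [add_sub_cancel_left] at this
    · intro α hα
      exact (mem_restrictSupport_iff K).1 hl hα

end HankelAux

/-- **Proposition 3.8(2).** Let `n = 2m-1`, `X` the generic square Hankel matrix of size `m`,
`P₁` (resp. `P₂`, `Q`) the Hankel matrix obtained from `X` by dropping the last row (resp. the
first column, resp. both). Then for every `3 ≤ t ≤ m` one has the primary decomposition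
`I_{t-1}(P₁) + I_{t-1}(P₂) = I_{t-1}(X) ∩ I_{t-2}(Q)`. -/
theorem hankel_primary_decomposition_two {K : Type*} [Field K] (m : ℕ) (t : ℕ)
    (ht3 : 3 ≤ t) (htm : t ≤ m) :
    minorsIdeal (t - 1) (hankelP1 K m) + minorsIdeal (t - 1) (hankelP2 K m) =
      minorsIdeal (t - 1) (hankelX K m) ⊓ minorsIdeal (t - 2) (hankelQ K m) := by
  obtain ⟨k, rfl⟩ := Nat.exists_eq_add_of_le (show 2 ≤ t by omega)
  rw [show 2 + k - 1 = k + 1 by omega, show 2 + k - 2 = k by omega, Submodule.add_eq_sup]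
  refine le_antisymm ?_ ?_
  · exact sup_le (le_inf (HankelAux.P1_le_X m _) (HankelAux.P1_le_Q m k))
      (le_inf (HankelAux.P2_le_X m _) (HankelAux.P2_le_Q m k))
  · intro f hf
    refine HankelAux.main_le m k (by omega)
      (f.support.sup (fun α => HankelAux.wt ((2 * m) ^ 2) α) + 1) f hf ?_
    intro α hα
    exact Nat.lt_succ_of_le
      (Finset.le_sup (f := fun α => HankelAux.wt ((2 * m) ^ 2) α) hα)
end
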